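/- arXiv:2410.20767 — 4 statements merged into one kernel-verified Lean document; each statement's English description precedes it below -/
import Mathlib

section
/- (Vosper) Let p be a prime and let A and B be nonempty subsets of F = ℤ/pℤ such that |A + B| < p. Then |A + B| = |A| + |B| − 1 if and only if at least one of the following holds: (i) min(|A|, |B|) = 1; (ii) |A + B| = p − 1 and B = F ∖ (c − A), where c is the unique element of F ∖ (A + B); (iii) A and B are arithmetic progressions with the same common difference. -/
open Pointwise

/-- `S` is an arithmetic progression in `ℤ/pℤ` with common difference `d`,
i.e. a set of the form `{x, x + d, x + 2d, …, x + (m−1)d}`. -/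
def IsAPWithDiff {p : ℕ} (S : Finset (ZMod p)) (d : ZMod p) : Prop :=
  ∃ x : ZMod p, ∃ m : ℕ, S = (Finset.range m).image fun j : ℕ => x + (j : ZMod p) * d

namespace IsAPWithDiff

variable {p : ℕ}

/-- If translation by `d ≠ 0` leaves `S` only through a single point `t ∉ S`, then `S` is an
arithmetic progression with common difference `d`. -/
theorem of_exit_unique [Fact p.Prime] {S : Finset (ZMod p)} {d t : ZMod p} (hd : d ≠ 0)
    (ht : t ∉ S) (h : ∀ y ∈ S, y + d ∉ S → y + d = t) : IsAPWithDiff S d := by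
  classical
  have hex : ∃ j : ℕ, t - ((j : ZMod p) + 1) * d ∉ S := by
    refine ⟨p - 1, ?_⟩
    rw [Nat.cast_pred (Fact.out : p.Prime).pos]
    simpa using ht
  refine ⟨t - (Nat.find hex : ZMod p) * d, Nat.find hex, ?_⟩
  have hdown : ∀ j k : ℕ, j + k < p → t - (((j + k : ℕ) : ZMod p) + 1) * d ∈ S →
      t - ((j : ZMod p) + 1) * d ∈ S := by
    intro j k
    induction k with
    | zero => intro _ hy; simpa using hy
    | succ k ih =>
      intro hlt hy
      refine ih (by omega) ?_
      by_contra hn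
      have e : t - (((j + (k + 1) : ℕ) : ZMod p) + 1) * d + d
          = t - (((j + k : ℕ) : ZMod p) + 1) * d := by push_cast; ring
      have hexit := h _ hy (by rwa [e])
      rw [e, sub_eq_self, mul_eq_zero, or_iff_left hd] at hexit
      have hdvd : p ∣ j + k + 1 := by
        rw [← ZMod.natCast_eq_zero_iff]
        exact_mod_cast hexit
      exact absurd (Nat.le_of_dvd (by omega) hdvd) (by omega)
  ext y
  simp only [Finset.mem_image, Finset.mem_range]
  constructor
  · intro hy
    set j := ((t - y) / d - 1).val with hj
    have hyj : t - ((j : ZMod p) + 1) * d = y := by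
      rw [hj, ZMod.natCast_val, ZMod.cast_id]
      field_simp
      ring
    have hjlt : j < Nat.find hex := by
      by_contra hle
      push Not at hle
      obtain ⟨k, hk⟩ := Nat.exists_eq_add_of_le hle
      refine Nat.find_spec hex (hdown _ k ?_ ?_)
      · rw [← hk]; exact ZMod.val_lt _
      · rw [← hk, hyj]; exact hy
    refine ⟨Nat.find hex - (j + 1), by omega, ?_⟩
    rw [Nat.cast_sub hjlt, ← hyj]
    push_cast
    ring
  · rintro ⟨i, hi, rfl⟩
    have hmem := Nat.find_min hex (m := Nat.find hex - (i + 1)) (by omega)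
    rw [not_not, Nat.cast_sub hi] at hmem
    convert hmem using 1
    push_cast
    ring

theorem compl [Fact p.Prime] {S : Finset (ZMod p)} {d : ZMod p} (hS : IsAPWithDiff S d)
    (hne : S.Nonempty) (hd : d ≠ 0) : IsAPWithDiff Sᶜ d := by
  obtain ⟨x, m, rfl⟩ := hS
  have hm : 0 < m := by simpa [Nat.pos_iff_ne_zero] using hne
  refine of_exit_unique (t := x) hd ?_ ?_
  · simpa using ⟨0, hm, by simp⟩
  · intro y hy hyd
    simp only [Finset.mem_compl, not_not, Finset.mem_image, Finset.mem_range] at hy hyd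
    obtain ⟨j, hj, hyj⟩ := hyd
    cases j with
    | zero => simpa using hyj.symm
    | succ j =>
      refine absurd ⟨j, by omega, ?_⟩ hy
      push_cast at hyj
      linear_combination hyj

theorem neg {S : Finset (ZMod p)} {d : ZMod p} (hS : IsAPWithDiff S d) :
    IsAPWithDiff (-S) d := by
  obtain ⟨x, m, rfl⟩ := hS
  refine ⟨-x - ((m : ZMod p) - 1) * d, m, ?_⟩
  ext y
  simp only [Finset.mem_neg, Finset.mem_image, Finset.mem_range, exists_exists_and_eq_and]
  constructor
  · rintro ⟨j, hj, rfl⟩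
    refine ⟨m - (j + 1), by omega, ?_⟩
    rw [Nat.cast_sub hj]
    push_cast
    ring
  · rintro ⟨j, hj, rfl⟩
    refine ⟨m - (j + 1), by omega, ?_⟩
    rw [Nat.cast_sub hj]
    push_cast
    ring

theorem ne_zero {S : Finset (ZMod p)} {d : ZMod p}
    (hS : IsAPWithDiff S d) (h : 2 ≤ S.card) : d ≠ 0 := by
  rintro rfl
  obtain ⟨x, m, rfl⟩ := hS
  have hsub : ((Finset.range m).image fun j : ℕ => x + (j : ZMod p) * 0) ⊆ {x} := by
    refine Finset.image_subset_iff.2 fun j _ => ?_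
    simp
  have := Finset.card_le_card hsub
  rw [Finset.card_singleton] at this
  omega

end IsAPWithDiff

theorem image_range_add_image_range {p : ℕ} (x y d : ZMod p) {m n : ℕ} (hm : 0 < m)
    (hn : 0 < n) :
    (Finset.range m).image (fun j : ℕ => x + (j : ZMod p) * d) +
        (Finset.range n).image (fun j : ℕ => y + (j : ZMod p) * d) =
      (Finset.range (m + n - 1)).image fun j : ℕ => x + y + (j : ZMod p) * d := by
  ext z
  simp only [Finset.mem_add, Finset.mem_image, Finset.mem_range, exists_exists_and_eq_and]
  constructor
  · rintro ⟨i, hi, j, hj, rfl⟩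
    exact ⟨i + j, by omega, by push_cast; ring⟩
  · rintro ⟨k, hk, rfl⟩
    refine ⟨min k (m - 1), by omega, k - min k (m - 1), by omega, ?_⟩
    rw [Nat.cast_sub (min_le_left _ _)]
    ring

theorem IsAPWithDiff.add {p : ℕ} {S T : Finset (ZMod p)} {d : ZMod p} (hS : IsAPWithDiff S d)
    (hT : IsAPWithDiff T d) (hSne : S.Nonempty) (hTne : T.Nonempty) :
    IsAPWithDiff (S + T) d := by
  obtain ⟨x, m, rfl⟩ := hS
  obtain ⟨y, n, rfl⟩ := hT
  exact ⟨x + y, m + n - 1, image_range_add_image_range x y d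
    (by simpa [Nat.pos_iff_ne_zero] using hSne) (by simpa [Nat.pos_iff_ne_zero] using hTne)⟩

theorem card_image_range_of_card_lt {p : ℕ} [Fact p.Prime] (x : ZMod p) {d : ZMod p}
    (hd : d ≠ 0) {m : ℕ}
    (h : ((Finset.range m).image fun j : ℕ => x + (j : ZMod p) * d).card < p) :
    ((Finset.range m).image fun j : ℕ => x + (j : ZMod p) * d).card = m := by
  have key : ∀ k ≤ p, ((Finset.range k).image fun j : ℕ => x + (j : ZMod p) * d).card = k := by
    intro k hk
    rw [Finset.card_image_of_injOn, Finset.card_range]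
    intro i hi j hj hij
    simp only [Finset.coe_range, Set.mem_Iio] at hi hj
    have hij' : (i : ZMod p) = j := mul_right_cancel₀ hd (add_left_cancel hij)
    rw [ZMod.natCast_eq_natCast_iff'] at hij'
    rwa [Nat.mod_eq_of_lt (by omega), Nat.mod_eq_of_lt (by omega)] at hij'
  refine key m ?_
  by_contra hm
  push Not at hm
  have hsub := Finset.card_le_card (Finset.image_subset_image
    (f := fun j : ℕ => x + (j : ZMod p) * d) (Finset.range_subset_range.2 hm.le))
  rw [key p le_rfl] at hsub
  omega

theorem ZMod.card_add_card_le_of_card_add_lt {p : ℕ} [Fact p.Prime] {A B : Finset (ZMod p)}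
    (hA : A.Nonempty) (hB : B.Nonempty) (h : (A + B).card < p) :
    A.card + B.card ≤ (A + B).card + 1 := by
  have := ZMod.cauchy_davenport (Fact.out : p.Prime) hA hB
  omega

/-- A pair `(A, B)` is critical if `|A + B| = |A| + |B| - 1`. In a critical pair whose sumset is
not all of `ZMod p`, if the first summand is an arithmetic progression with at least two elements,
then so is the second, with the same common difference. -/
theorem IsAPWithDiff.of_critical {p : ℕ} [Fact p.Prime] {A B : Finset (ZMod p)} {d : ZMod p}
    (hA : IsAPWithDiff A d) (hA2 : 2 ≤ A.card) (hB : B.Nonempty)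
    (hAB : (A + B).card + 1 = A.card + B.card) (hlt : (A + B).card < p) :
    IsAPWithDiff B d := by
  classical
  have hAlt : A.card < p := (Finset.card_le_card_add_right hB).trans_lt hlt
  have hBlt : B.card < p :=
    (Finset.card_le_card_add_left (Finset.card_pos.1 (by omega))).trans_lt hlt
  have hd := hA.ne_zero hA2
  obtain ⟨x, m, rfl⟩ := hA
  have hm : 2 ≤ m := hA2.trans (Finset.card_image_le.trans (by simp))
  have hcard := card_image_range_of_card_lt x hd hAlt
  set P := (Finset.range 2).image fun j : ℕ => (0 : ZMod p) + (j : ZMod p) * d with hP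
  set Q := (Finset.range (m - 1)).image fun j : ℕ => x + (j : ZMod p) * d with hQ
  have hQP : Q + P = (Finset.range m).image fun j : ℕ => x + (j : ZMod p) * d := by
    rw [hQ, hP, image_range_add_image_range _ _ _ (by omega) (by omega),
      show m - 1 + 2 - 1 = m by omega, add_zero]
  have hQne : Q.Nonempty := by simp [hQ]; omega
  have hPne : P.Nonempty := by simp [hP]
  have hQcard : Q.card = m - 1 := by
    refine card_image_range_of_card_lt x hd (lt_of_le_of_lt ?_ hAlt)
    rw [← hQP]
    exact Finset.card_le_card_add_right hPne
  have hsum : Q + (P + B) = (Finset.range m).image (fun j : ℕ => x + (j : ZMod p) * d) + B := by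
    rw [← hQP, add_assoc]
  have hCD := ZMod.card_add_card_le_of_card_add_lt hQne (hPne.add hB) (by rwa [hsum])
  rw [hsum] at hCD
  have hmemP : ∀ y ∈ B, y + d ∈ P + B := fun y hy =>
    Finset.mem_add.2 ⟨d, by simpa [hP] using ⟨1, by norm_num, by simp⟩, y, hy, add_comm _ _⟩
  have hBsub : B ⊆ P + B := fun y hy =>
    Finset.mem_add.2 ⟨0, by simpa [hP] using ⟨0, by norm_num, by simp⟩, y, hy, zero_add _⟩
  have hdiff : ((P + B) \ B).card ≤ 1 := by
    rw [Finset.card_sdiff_of_subset hBsub]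
    omega
  obtain hempty | ⟨t, ht⟩ := ((P + B) \ B).eq_empty_or_nonempty
  · obtain ⟨t, ht⟩ : ∃ t, t ∉ B := by
      by_contra! hall
      rw [Finset.eq_univ_iff_forall.2 hall, Finset.card_univ, ZMod.card] at hBlt
      exact lt_irrefl _ hBlt
    refine IsAPWithDiff.of_exit_unique hd ht fun y hy hyd => ?_
    have : y + d ∈ (P + B) \ B := Finset.mem_sdiff.2 ⟨hmemP y hy, hyd⟩
    simp [hempty] at this
  · refine IsAPWithDiff.of_exit_unique hd (Finset.mem_sdiff.1 ht).2 fun y hy hyd => ?_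
    exact Finset.card_le_one.1 hdiff _ (Finset.mem_sdiff.2 ⟨hmemP y hy, hyd⟩) _ ht

/-- In a critical pair whose sumset is an arithmetic progression missing at least two elements,
the second summand is an arithmetic progression with the same common difference. -/
theorem IsAPWithDiff.right_of_add {p : ℕ} [Fact p.Prime] {A B : Finset (ZMod p)} {d : ZMod p}
    (hS : IsAPWithDiff (A + B) d) (hA : 2 ≤ A.card) (hB : 2 ≤ B.card)
    (hAB : (A + B).card + 1 = A.card + B.card) (hlt : (A + B).card + 2 ≤ p) :
    IsAPWithDiff B d := by
  have hd : d ≠ 0 := hS.ne_zero (by omega)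
  have hBne : B.Nonempty := Finset.card_pos.1 (by omega)
  have hD : IsAPWithDiff (A + B)ᶜ d := hS.compl (Finset.card_pos.1 (by omega)) hd
  have hDcard : (A + B)ᶜ.card = p - (A + B).card := by rw [Finset.card_compl, ZMod.card]
  have hsub : (A + B)ᶜ + -B ⊆ Aᶜ := by
    intro z hz
    obtain ⟨u, hu, v, hv, rfl⟩ := Finset.mem_add.1 hz
    rw [Finset.mem_compl] at hu ⊢
    exact fun hmem => hu (Finset.mem_add.2 ⟨u + v, hmem, -v, Finset.mem_neg'.1 hv, by ring⟩)
  have hle := Finset.card_le_card hsub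
  rw [Finset.card_compl, ZMod.card] at hle
  have hCD := ZMod.card_add_card_le_of_card_add_lt (A := (A + B)ᶜ) (B := -B)
    (Finset.card_pos.1 (by omega)) hBne.neg (by omega)
  have hneg : (-B).card = B.card := Finset.card_neg B
  have := hD.of_critical (by omega) hBne.neg (by omega) (by omega)
  simpa using this.neg

theorem exists_isAPWithDiff_of_card_eq_two {p : ℕ} {B : Finset (ZMod p)} (hB : B.card = 2) :
    ∃ d, IsAPWithDiff B d := by
  obtain ⟨x, y, -, rfl⟩ := Finset.card_eq_two.1 hB
  exact ⟨y - x, x, 2, by simp [Finset.range_add_one, Finset.pair_comm]⟩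

/-- A critical pair `(A, B)` with `|B| ≥ 3` has a translate of `B` meeting `A` in at least two but
fewer than `|B|` points. -/
theorem exists_card_inter_vadd {p : ℕ} [Fact p.Prime] {A B : Finset (ZMod p)}
    (hA : 2 ≤ A.card) (hB : 3 ≤ B.card) (hAB : (A + B).card + 1 = A.card + B.card)
    (hlt : (A + B).card < p) :
    ∃ e : ZMod p, 2 ≤ (B ∩ (-e +ᵥ A)).card ∧ (B ∩ (-e +ᵥ A)).card < B.card := by
  classical
  by_contra! hcon
  have hAne : A.Nonempty := Finset.card_pos.1 (by omega)
  have hBne : B.Nonempty := Finset.card_pos.1 (by omega)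
  obtain ⟨b, hb⟩ := hBne
  have hmem : ∀ e z : ZMod p, z ∈ -e +ᵥ A ↔ e + z ∈ A := by
    intro e z
    rw [Finset.mem_neg_vadd_finset_iff, vadd_eq_add]
  set X := A.filter fun a => ¬ (∀ z ∈ B, a - b + z ∈ A) with hX
  set Y := A.filter fun a => ∀ z ∈ B, a - b + z ∈ A with hY
  have hXY : Y.card + X.card = A.card := Finset.card_filter_add_card_filter_not _
  have hX2 : 2 ≤ X.card := by
    obtain hYe | hYne := Y.eq_empty_or_nonempty
    · rw [hYe, Finset.card_empty] at hXY
      omega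
    · have hsub : Y + B ⊆ b +ᵥ A := by
        intro w hw
        obtain ⟨a, ha, z, hz, rfl⟩ := Finset.mem_add.1 hw
        refine Finset.mem_vadd_finset.2 ⟨a - b + z, (Finset.mem_filter.1 ha).2 z hz, ?_⟩
        rw [vadd_eq_add]
        ring
      have hle := Finset.card_le_card hsub
      rw [Finset.card_vadd_finset] at hle
      have hA' : A.card ≤ (A + B).card := Finset.card_le_card_add_right ⟨b, hb⟩
      have := ZMod.card_add_card_le_of_card_add_lt hYne ⟨b, hb⟩ (by omega)
      omega
  have hinter : ∀ a ∈ X, ∀ z ∈ B, a - b + z ∈ A → z = b := by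
    intro a ha z hz haz
    obtain ⟨haA, hnot⟩ := Finset.mem_filter.1 ha
    by_contra hzb
    refine hnot fun w hw => ?_
    have h2 : 2 ≤ (B ∩ (-(a - b) +ᵥ A)).card := by
      rw [← Finset.card_pair hzb]
      refine Finset.card_le_card fun w hw => ?_
      rw [Finset.mem_insert, Finset.mem_singleton] at hw
      obtain rfl | rfl := hw
      · exact Finset.mem_inter.2 ⟨hz, (hmem _ _).2 haz⟩
      · exact Finset.mem_inter.2 ⟨hb, (hmem _ _).2 (by simpa using haA)⟩
    have heq := Finset.eq_of_subset_of_card_le Finset.inter_subset_left (hcon _ h2)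
    rw [← heq] at hw
    exact (hmem _ _).1 (Finset.mem_inter.1 hw).2
  have hsub : X + B.erase b ⊆ (A + B) \ (b +ᵥ A) := by
    intro w hw
    obtain ⟨a, ha, z, hz, rfl⟩ := Finset.mem_add.1 hw
    rw [Finset.mem_erase] at hz
    refine Finset.mem_sdiff.2
      ⟨Finset.add_mem_add (Finset.mem_filter.1 ha).1 hz.2, fun hbad => ?_⟩
    obtain ⟨c, hc, hce⟩ := Finset.mem_vadd_finset.1 hbad
    rw [vadd_eq_add] at hce
    refine hz.1 (hinter a ha z hz.2 ?_)
    rwa [show a - b + z = c by linear_combination -hce]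
  have hbA : b +ᵥ A ⊆ A + B := by
    intro w hw
    obtain ⟨c, hc, rfl⟩ := Finset.mem_vadd_finset.1 hw
    rw [vadd_eq_add, add_comm b c]
    exact Finset.add_mem_add hc hb
  have hle := Finset.card_le_card hsub
  rw [Finset.card_sdiff_of_subset hbA, Finset.card_vadd_finset] at hle
  have hBe : (B.erase b).card = B.card - 1 := Finset.card_erase_of_mem hb
  have := ZMod.card_add_card_le_of_card_add_lt (A := X) (B := B.erase b)
    (Finset.card_pos.1 (by omega)) (Finset.card_pos.1 (by omega)) (by omega)
  omega

/-- The main case of Vosper's theorem: a critical pair of sets with at least two elements each,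
whose sumset misses at least two elements, consists of arithmetic progressions with the same
common difference. -/
theorem exists_isAPWithDiff_of_critical {p : ℕ} [Fact p.Prime] (A B : Finset (ZMod p))
    (hA : 2 ≤ A.card) (hB : 2 ≤ B.card) (hAB : (A + B).card + 1 = A.card + B.card)
    (hlt : (A + B).card + 2 ≤ p) :
    ∃ d : ZMod p, IsAPWithDiff A d ∧ IsAPWithDiff B d := by
  induction hn : B.card using Nat.strong_induction_on generalizing A B with
  | _ n ih =>
  have hAne : A.Nonempty := Finset.card_pos.1 (by omega)
  have of_right : ∀ d, IsAPWithDiff B d → ∃ d, IsAPWithDiff A d ∧ IsAPWithDiff B d := by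
    intro d hBd
    have hcomm := add_comm B A
    exact ⟨d, hBd.of_critical hB hAne (by rw [hcomm]; omega) (by rw [hcomm]; omega), hBd⟩
  obtain hB2 | hB3 := hB.eq_or_lt
  · obtain ⟨d, hd⟩ := exists_isAPWithDiff_of_card_eq_two hB2.symm
    exact of_right d hd
  · obtain ⟨e, he2, helt⟩ := exists_card_inter_vadd hA hB3 hAB (by omega)
    have hsub := Finset.addDysonETransform.subset e (A, B)
    have hcard := Finset.addDysonETransform.card e (A, B)
    set A' := (Finset.addDysonETransform e (A, B)).1 with hA'
    set B' := (Finset.addDysonETransform e (A, B)).2 with hB'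
    have hB'eq : B' = B ∩ (-e +ᵥ A) := rfl
    rw [← hB'eq] at he2 helt
    dsimp only at hsub hcard
    have hle := Finset.card_le_card hsub
    have hCD := ZMod.card_add_card_le_of_card_add_lt (A := A') (B := B')
      (Finset.card_pos.1 (by omega)) (Finset.card_pos.1 (by omega)) (by omega)
    obtain ⟨d, hA'd, hB'd⟩ := ih B'.card (by omega) A' B' (by omega) he2 (by omega) (by omega) rfl
    have hS := hA'd.add hB'd (Finset.card_pos.1 (by omega)) (Finset.card_pos.1 (by omega))
    rw [Finset.eq_of_subset_of_card_le hsub (by omega)] at hS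
    exact of_right d (hS.right_of_add hA hB hAB hlt)

/-- (Vosper) Let `p` be a prime and let `A` and `B` be nonempty subsets of `F = ℤ/pℤ`
such that `|A + B| < p`.  Then `|A + B| = |A| + |B| − 1` if and only if at least one of
the following holds: (i) `min(|A|, |B|) = 1`; (ii) `|A + B| = p − 1` and
`B = F ∖ (c − A)`, where `c` is the unique element of `F ∖ (A + B)`;
(iii) `A` and `B` are arithmetic progressions with the same common difference. -/
theorem vosper (p : ℕ) [Fact p.Prime] (A B : Finset (ZMod p))
    (hA : A.Nonempty) (hB : B.Nonempty) (hlt : (A + B).card < p) :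
    (A + B).card = A.card + B.card - 1 ↔
      (min A.card B.card = 1 ∨
        ((A + B).card = p - 1 ∧
          ∃ c : ZMod p, Finset.univ \ (A + B) = {c} ∧
            B = Finset.univ \ A.image (fun a => c - a)) ∨
        ∃ d : ZMod p, IsAPWithDiff A d ∧ IsAPWithDiff B d) := by
  have hA0 := hA.card_pos
  have hB0 := hB.card_pos
  have hCD := ZMod.card_add_card_le_of_card_add_lt hA hB hlt
  have hAle : A.card ≤ (A + B).card := Finset.card_le_card_add_right hB
  have hBle : B.card ≤ (A + B).card := Finset.card_le_card_add_left hA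
  have himage : ∀ c : ZMod p,
      (Finset.univ \ A.image (fun a => c - a)).card = p - A.card := by
    intro c
    rw [Finset.card_sdiff_of_subset (Finset.subset_univ _), Finset.card_univ, ZMod.card,
      Finset.card_image_of_injective _ sub_right_injective]
  have hone : A.card = 1 ∨ B.card = 1 → (A + B).card = A.card + B.card - 1 := by
    have hmul : (A + B).card ≤ A.card * B.card := Finset.card_add_le
    rintro (h | h) <;> rw [h] at hmul <;> omega
  constructor
  · intro h
    by_cases hmin : min A.card B.card = 1
    · exact Or.inl hmin
    by_cases hp : (A + B).card = p - 1
    · refine Or.inr (Or.inl ⟨hp, ?_⟩)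
      obtain ⟨c, hc⟩ : ∃ c, Finset.univ \ (A + B) = {c} := by
        rw [← Finset.card_eq_one, Finset.card_sdiff_of_subset (Finset.subset_univ _),
          Finset.card_univ, ZMod.card]
        omega
      refine ⟨c, hc, Finset.eq_of_subset_of_card_le (fun b hb => ?_) ?_⟩
      · have hcmem : c ∈ Finset.univ \ (A + B) := hc ▸ Finset.mem_singleton_self c
        refine Finset.mem_sdiff.2 ⟨Finset.mem_univ _, fun hbad => ?_⟩
        obtain ⟨a, ha, rfl⟩ := Finset.mem_image.1 hbad
        exact (Finset.mem_sdiff.1 hcmem).2 (Finset.mem_add.2 ⟨a, ha, _, hb, by ring⟩)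
      · rw [himage]
        omega
    · exact Or.inr (Or.inr (exists_isAPWithDiff_of_critical A B (by omega) (by omega)
        (by omega) (by omega)))
  · rintro (hmin | ⟨hp, c, -, hBc⟩ | ⟨d, hAd, hBd⟩)
    · exact hone (by omega)
    · have := himage c
      rw [← hBc] at this
      omega
    · by_cases h2 : 2 ≤ A.card
      · have hd := hAd.ne_zero h2
        obtain ⟨x, m, rfl⟩ := hAd
        obtain ⟨y, n, rfl⟩ := hBd
        have hm := card_image_range_of_card_lt x hd (hAle.trans_lt hlt)
        have hn := card_image_range_of_card_lt y hd (hBle.trans_lt hlt)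
        have hle : _ ≤ _ := (congrArg Finset.card (image_range_add_image_range x y d
          (m := m) (n := n) (by omega) (by omega))).trans_le Finset.card_image_le
        rw [Finset.card_range] at hle
        omega
      · exact hone (by omega)
end

section
/- (Hamidoune–Rødseth) Let p be a prime and let A and B be subsets of ℤ/pℤ with |A| ≥ 3 and |B| ≥ 4 such that |A + B| = |A| + |B| ≤ p − 4. Then A and B are contained in arithmetic progressions with the same common difference, of respective lengths |A| + 1 and |B| + 1. -/
open Pointwise

namespace HamidouneRodseth

variable {p : ℕ} [Fact p.Prime]

/-- The triples of sets such that no `a + b + c` vanishes. -/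
def Trio (A B C : Finset (ZMod p)) : Prop := ∀ a ∈ A, ∀ b ∈ B, ∀ c ∈ C, a + b + c ≠ 0

/-- The elements of `X` whose translate by `g` is again in `X`. -/
def inter (X : Finset (ZMod p)) (g : ZMod p) : Finset (ZMod p) := X.filter fun x => x + g ∈ X

/-- The union of `X` and its translate by `g`. -/
def union (X : Finset (ZMod p)) (g : ZMod p) : Finset (ZMod p) := X ∪ X.image (· + g)

/-- The arithmetic progression `x, x + d, …, x + (n - 1) d`. -/
def ap (x d : ZMod p) (n : ℕ) : Finset (ZMod p) :=
  (Finset.range n).image fun j : ℕ => x + (j : ZMod p) * d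

lemma mem_inter {X : Finset (ZMod p)} {g x : ZMod p} : x ∈ inter X g ↔ x ∈ X ∧ x + g ∈ X := by
  simp [inter]

lemma mem_union {X : Finset (ZMod p)} {g x : ZMod p} : x ∈ union X g ↔ x ∈ X ∨ x - g ∈ X := by
  simp only [union, Finset.mem_union, Finset.mem_image]
  constructor
  · rintro (h | ⟨y, hy, rfl⟩)
    · exact Or.inl h
    · right; simpa using hy
  · rintro (h | h)
    · exact Or.inl h
    · exact Or.inr ⟨_, h, by ring⟩

lemma mem_ap {x d y : ZMod p} {n : ℕ} : y ∈ ap x d n ↔ ∃ j < n, y = x + (j : ZMod p) * d := by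
  simp only [ap, Finset.mem_image, Finset.mem_range]
  constructor
  · rintro ⟨j, hj, rfl⟩; exact ⟨j, hj, rfl⟩
  · rintro ⟨j, hj, rfl⟩; exact ⟨j, hj, rfl⟩

lemma Trio.swap {A B C : Finset (ZMod p)} (h : Trio A B C) : Trio B A C := by
  intro b hb a ha c hc
  rw [add_comm b a]
  exact h a ha b hb c hc

lemma Trio.rotate {A B C : Finset (ZMod p)} (h : Trio A B C) : Trio B C A := by
  intro b hb c hc a ha
  have := h a ha b hb c hc
  rwa [show b + c + a = a + b + c by ring]

lemma Trio.inter_union {A B C : Finset (ZMod p)} (h : Trio A B C) (g : ZMod p) :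
    Trio (inter A g) (union B g) C := by
  intro a ha b hb c hc
  rw [mem_inter] at ha
  rw [mem_union] at hb
  rcases hb with hb | hb
  · exact h a ha.1 b hb c hc
  · have := h _ ha.2 _ hb c hc
    rwa [show a + g + (b - g) + c = a + b + c by ring] at this

lemma Trio.union_inter {A B C : Finset (ZMod p)} (h : Trio A B C) (g : ZMod p) :
    Trio (union A g) (inter B g) C :=
  (h.swap.inter_union g).swap

lemma Trio.card_add_le {A B C : Finset (ZMod p)} (h : Trio A B C) :
    (A + B).card + C.card ≤ p := by
  have hd : Disjoint (A + B) (C.image fun c => -c) := by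
    rw [Finset.disjoint_left]
    intro x hx hx'
    obtain ⟨a, ha, b, hb, rfl⟩ := Finset.mem_add.1 hx
    obtain ⟨c, hc, hc'⟩ := Finset.mem_image.1 hx'
    apply h a ha b hb c hc
    rw [← hc']; ring
  have h1 := Finset.card_union_of_disjoint hd
  rw [Finset.card_image_of_injective _ neg_injective] at h1
  have h2 := Finset.card_le_univ ((A + B) ∪ C.image fun c => -c)
  rw [ZMod.card] at h2
  omega

lemma Trio.card_le {A B C : Finset (ZMod p)} (h : Trio A B C) (hA : A.Nonempty)
    (hB : B.Nonempty) (hC : C.Nonempty) : A.card + B.card + C.card ≤ p + 1 := by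
  have h1 := ZMod.cauchy_davenport (Fact.out : p.Prime) hA hB
  have h2 := h.card_add_le
  have := hC.card_pos
  have := hA.card_pos
  have := hB.card_pos
  rcases min_le_iff.1 h1 with h | h <;> omega

lemma card_union_add_card_inter (X : Finset (ZMod p)) (g : ZMod p) :
    (union X g).card + (inter X g).card = 2 * X.card := by
  have h1 := Finset.card_union_add_card_inter X (X.image (· + g))
  rw [Finset.card_image_of_injective _ (add_left_injective g)] at h1
  have h2 : X ∩ X.image (· + g) = (inter X g).image (· + g) := by
    ext x
    simp only [Finset.mem_inter, Finset.mem_image, mem_inter]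
    constructor
    · rintro ⟨hx, y, hy, rfl⟩; exact ⟨y, ⟨hy, hx⟩, rfl⟩
    · rintro ⟨y, ⟨hy, hx⟩, rfl⟩; exact ⟨hx, y, hy, rfl⟩
  rw [h2, Finset.card_image_of_injective _ (add_left_injective g)] at h1
  rw [union]; omega

lemma inter_subset (X : Finset (ZMod p)) (g : ZMod p) : inter X g ⊆ X :=
  Finset.filter_subset _ _

lemma subset_union (X : Finset (ZMod p)) (g : ZMod p) : X ⊆ union X g :=
  Finset.subset_union_left

lemma card_inter_le (X : Finset (ZMod p)) (g : ZMod p) : (inter X g).card ≤ X.card :=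
  Finset.card_le_card (inter_subset X g)

lemma card_le_card_union (X : Finset (ZMod p)) (g : ZMod p) : X.card ≤ (union X g).card :=
  Finset.card_le_card (subset_union X g)

lemma card_le_card_inter_union (X : Finset (ZMod p)) (g : ZMod p) :
    X.card ≤ (inter (union X g) g).card := by
  apply Finset.card_le_card
  intro x hx
  rw [mem_inter, mem_union, mem_union]
  exact ⟨Or.inl hx, Or.inr (by simpa using hx)⟩

lemma eq_univ_of_forall_add_mem {X : Finset (ZMod p)} {g : ZMod p} (hg : g ≠ 0)
    (hX : X.Nonempty) (h : ∀ x ∈ X, x + g ∈ X) : X = Finset.univ := by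
  obtain ⟨x, hx⟩ := hX
  have key : ∀ n : ℕ, x + (n : ZMod p) * g ∈ X := by
    intro n
    induction n with
    | zero => simpa using hx
    | succ n ih =>
      have := h _ ih
      push_cast
      rwa [show x + ((n : ZMod p) + 1) * g = x + n * g + g by ring]
  ext z
  simp only [Finset.mem_univ, iff_true]
  have := key ((z - x) / g).val
  rw [ZMod.natCast_val, ZMod.cast_id', id, div_mul_cancel₀ _ hg] at this
  simpa using this

lemma card_univ' : (Finset.univ : Finset (ZMod p)).card = p := by
  rw [Finset.card_univ, ZMod.card]

lemma card_inter_lt {X : Finset (ZMod p)} {g : ZMod p} (hg : g ≠ 0) (hX : X.Nonempty)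
    (hp : X.card < p) : (inter X g).card < X.card := by
  apply Finset.card_lt_card
  refine (Finset.ssubset_iff_subset_ne).2 ⟨inter_subset X g, fun he => ?_⟩
  have : X = Finset.univ := by
    apply eq_univ_of_forall_add_mem hg hX
    intro x hx
    rw [← he, mem_inter] at hx
    exact hx.2
  rw [this, card_univ'] at hp
  exact lt_irrefl _ hp

lemma natCast_mul_inj {d : ZMod p} (hd : d ≠ 0) {i j : ℕ} (hi : i < p) (hj : j < p)
    (h : (i : ZMod p) * d = j * d) : i = j := by
  have := mul_right_cancel₀ hd h
  rw [ZMod.natCast_eq_natCast_iff'] at this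
  rwa [Nat.mod_eq_of_lt hi, Nat.mod_eq_of_lt hj] at this

lemma card_ap {x d : ZMod p} (hd : d ≠ 0) {n : ℕ} (hn : n ≤ p) : (ap x d n).card = n := by
  rw [ap, Finset.card_image_of_injOn, Finset.card_range]
  intro i hi j hj hij
  simp only [Finset.coe_range, Set.mem_Iio] at hi hj
  exact natCast_mul_inj hd (by omega) (by omega) (add_left_cancel hij)

lemma ap_mono {x d : ZMod p} {m n : ℕ} (h : m ≤ n) : ap x d m ⊆ ap x d n := by
  intro y hy
  obtain ⟨j, hj, rfl⟩ := mem_ap.1 hy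
  exact mem_ap.2 ⟨j, by omega, rfl⟩

lemma ap_neg {x d : ZMod p} {n : ℕ} : ap x d n ⊆ ap (x + ((n - 1 : ℕ) : ZMod p) * d) (-d) n := by
  intro y hy
  obtain ⟨j, hj, rfl⟩ := mem_ap.1 hy
  refine mem_ap.2 ⟨n - 1 - j, by omega, ?_⟩
  have : ((n - 1 : ℕ) : ZMod p) = ((n - 1 - j : ℕ) : ZMod p) + (j : ZMod p) := by
    rw [← Nat.cast_add]; congr 1; omega
  rw [this]; ring

lemma ap_pair {u v : ZMod p} : ({u, v} : Finset (ZMod p)) ⊆ ap u (v - u) 2 := by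
  intro y hy
  rw [Finset.mem_insert, Finset.mem_singleton] at hy
  rcases hy with rfl | rfl
  · exact mem_ap.2 ⟨0, by norm_num, by simp⟩
  · exact mem_ap.2 ⟨1, by norm_num, by simp⟩

/-- A set with at most one element `x` such that `x + d` is not in it is an arithmetic
progression. -/
lemma exists_subset_ap {X : Finset (ZMod p)} {d : ZMod p} (hd : d ≠ 0) (hX : X.Nonempty)
    (hp : X.card < p) (h : X.card ≤ (inter X d).card + 1) : ∃ s, X ⊆ ap s d X.card := by
  have hlt := card_inter_lt hd hX hp
  have h1 : (X \ inter X d).card = 1 := by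
    rw [Finset.card_sdiff_of_subset (inter_subset X d)]; omega
  obtain ⟨e, he⟩ := Finset.card_eq_one.1 h1
  have hstep : ∀ x ∈ X, x ≠ e → x + d ∈ X := by
    intro x hx hxe
    by_contra hc
    have : x ∈ X \ inter X d := by
      rw [Finset.mem_sdiff, mem_inter]; exact ⟨hx, fun h => hc h.2⟩
    rw [he, Finset.mem_singleton] at this
    exact hxe this
  have hsub : X ⊆ ap e (-d) X.card := by
    intro x hx
    by_contra hc
    have hne : ∀ k < X.card, x + (k : ZMod p) * d ≠ e := by
      intro k hk hke
      exact hc (mem_ap.2 ⟨k, hk, by rw [← hke]; ring⟩)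
    have hmem : ∀ k ≤ X.card, x + (k : ZMod p) * d ∈ X := by
      intro k
      induction k with
      | zero => intro _; simpa using hx
      | succ k ih =>
        intro hk
        have := hstep _ (ih (by omega)) (hne k (by omega))
        push_cast
        rwa [show x + ((k : ZMod p) + 1) * d = x + k * d + d by ring]
    have hs : ap x d (X.card + 1) ⊆ X := by
      intro y hy
      obtain ⟨j, hj, rfl⟩ := mem_ap.1 hy
      exact hmem j (by omega)
    have := Finset.card_le_card hs
    rw [card_ap hd (by omega)] at this
    omega
  have := hsub.trans ap_neg
  rw [neg_neg] at this
  exact ⟨_, this⟩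

lemma ap_subset_of_subset_ap {X : Finset (ZMod p)} {s d : ZMod p} (hd : d ≠ 0)
    (hp : X.card ≤ p) (h : X ⊆ ap s d X.card) : X = ap s d X.card :=
  Finset.eq_of_subset_of_card_le h (by rw [card_ap hd hp])

lemma subset_ap_of_union_subset {X : Finset (ZMod p)} {s d : ZMod p} {m : ℕ} (hd : d ≠ 0)
    (hm : m + 1 < p) (h : union X d ⊆ ap s d (m + 1)) : X ⊆ ap s d m := by
  intro x hx
  obtain ⟨j, hj, hxj⟩ := mem_ap.1 (h (subset_union X d hx))
  refine mem_ap.2 ⟨j, ?_, hxj⟩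
  by_contra hc
  have hjm : j = m := by omega
  have hx' : x + d ∈ union X d := mem_union.2 (Or.inr (by simpa using hx))
  obtain ⟨i, hi, hxi⟩ := mem_ap.1 (h hx')
  have : ((m + 1 : ℕ) : ZMod p) * d = (i : ZMod p) * d := by
    rw [hxj, hjm] at hxi
    push_cast
    linear_combination hxi
  have := natCast_mul_inj hd hm (by omega) this
  omega

lemma Trio.union_ap {A B : Finset (ZMod p)} {z d : ZMod p} {n : ℕ}
    (h : Trio A B (ap z d (n + 1))) : Trio (union A d) B (ap z d n) := by
  intro a ha b hb c hc
  obtain ⟨j, hj, rfl⟩ := mem_ap.1 hc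
  rcases mem_union.1 ha with ha | ha
  · exact h a ha b hb _ (mem_ap.2 ⟨j, by omega, rfl⟩)
  · have := h _ ha b hb _ (mem_ap.2 ⟨j + 1, by omega, rfl⟩)
    push_cast at this
    rwa [show a - d + b + (z + ((j : ZMod p) + 1) * d) = a + b + (z + j * d) by ring] at this

lemma ap_nonempty {x d : ZMod p} {n : ℕ} (hn : 0 < n) : (ap x d n).Nonempty :=
  ⟨x, mem_ap.2 ⟨0, hn, by simp⟩⟩

lemma union_nonempty {X : Finset (ZMod p)} {g : ZMod p} (h : X.Nonempty) :
    (union X g).Nonempty := h.mono (subset_union X g)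

lemma Trio.card_union_le {A B : Finset (ZMod p)} {z d : ZMod p} {n : ℕ} (hd : d ≠ 0)
    (hn : 1 ≤ n) (hnp : n ≤ p) (hA : A.Nonempty) (hB : B.Nonempty)
    (h : Trio A B (ap z d (n + 1))) : (union A d).card + B.card + n ≤ p + 1 := by
  have := h.union_ap.card_le (union_nonempty hA) hB (ap_nonempty hn)
  rwa [card_ap hd hnp] at this

lemma Trio.card_union_union_le {A B : Finset (ZMod p)} {z d : ZMod p} {n : ℕ} (hd : d ≠ 0)
    (hn : 1 ≤ n) (hnp : n ≤ p) (hA : A.Nonempty) (hB : B.Nonempty)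
    (h : Trio A B (ap z d (n + 2))) :
    (union (union A d) d).card + B.card + n ≤ p + 1 :=
  h.union_ap.card_union_le hd hn hnp (union_nonempty hA) hB

/-- Extremality in Cauchy–Davenport against a progression forces a progression. -/
lemma Trio.exists_subset_ap {A B : Finset (ZMod p)} {z d : ZMod p} {n : ℕ} (hd : d ≠ 0)
    (hn : 2 ≤ n) (hnp : n ≤ p) (hA : A.Nonempty) (hB : B.Nonempty)
    (h : Trio A B (ap z d n)) (hs : p + 1 ≤ A.card + B.card + n) : ∃ s, A ⊆ ap s d A.card := by
  obtain ⟨m, rfl⟩ : ∃ m, n = m + 1 := ⟨n - 1, by omega⟩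
  have h1 := h.card_union_le hd (by omega) (by omega) hA hB
  have h2 := card_union_add_card_inter A d
  have h3 := hB.card_pos
  have h4 := card_le_card_union A d
  exact HamidouneRodseth.exists_subset_ap hd hA (by omega) (by omega)

/-- Near-extremality in Cauchy–Davenport against a progression forces a progression with at most
one element missing. -/
lemma Trio.exists_subset_ap_succ {A B : Finset (ZMod p)} {z d : ZMod p} {n : ℕ} (hd : d ≠ 0)
    (hn : 3 ≤ n) (hnp : n ≤ p) (hA : A.Nonempty) (hB : B.Nonempty)
    (h : Trio A B (ap z d n)) (hs : p ≤ A.card + B.card + n) :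
    ∃ s, A ⊆ ap s d (A.card + 1) := by
  obtain ⟨m, rfl⟩ : ∃ m, n = m + 2 := ⟨n - 2, by omega⟩
  have h1 := h.card_union_union_le hd (by omega) (by omega) hA hB
  have h1' := h.card_union_le hd (by omega) (by omega) hA hB
  have h2 := card_union_add_card_inter A d
  have h3 := card_union_add_card_inter (union A d) d
  have h4 := hB.card_pos
  have h5 := card_le_card_inter_union A d
  have h6 := card_inter_lt hd (union_nonempty (g := d) hA) (by omega)
  obtain ⟨s, hs⟩ := HamidouneRodseth.exists_subset_ap hd (union_nonempty (g := d) hA) (by omega)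
    (by omega)
  refine ⟨s, subset_ap_of_union_subset hd (m := A.card + 1) ?_ (hs.trans (ap_mono ?_))⟩
  · have := hA.card_pos
    omega
  · omega

/-- The elements of `A` that take part in a solution of `a + b + z = 0` with `b ∈ B`. -/
def partners (A B : Finset (ZMod p)) (z : ZMod p) : Finset (ZMod p) :=
  A.filter fun x => -(x + z) ∈ B

lemma mem_partners {A B : Finset (ZMod p)} {z x : ZMod p} :
    x ∈ partners A B z ↔ x ∈ A ∧ -(x + z) ∈ B := by
  simp [partners]

lemma card_partners_le (A B : Finset (ZMod p)) (z : ZMod p) :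
    (partners A B z).card ≤ (partners B A z).card := by
  apply Finset.card_le_card_of_injOn (fun x => -(x + z))
  · intro x hx
    rw [Finset.mem_coe, mem_partners] at hx ⊢
    exact ⟨hx.2, by simpa using hx.1⟩
  · intro x _ y _ hxy
    simpa using hxy

lemma card_partners_comm (A B : Finset (ZMod p)) (z : ZMod p) :
    (partners A B z).card = (partners B A z).card :=
  le_antisymm (card_partners_le A B z) (card_partners_le B A z)

/-- `A + B` avoids the negatives of all terms of a progression of length `c + 1` but the term of
index `i`. -/
def TrioExcept (A B : Finset (ZMod p)) (z d : ZMod p) (c i : ℕ) : Prop :=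
  ∀ a ∈ A, ∀ b ∈ B, ∀ j ≤ c, j ≠ i → a + b + (z + (j : ZMod p) * d) ≠ 0

lemma TrioExcept.swap {A B : Finset (ZMod p)} {z d : ZMod p} {c i : ℕ}
    (h : TrioExcept A B z d c i) : TrioExcept B A z d c i := by
  intro a ha b hb j hj hji
  rw [add_comm a b]
  exact h b hb a ha j hj hji

lemma TrioExcept.trio_sdiff {A B : Finset (ZMod p)} {z d : ZMod p} {c i : ℕ}
    (h : TrioExcept A B z d c i) :
    Trio A (B \ partners B A (z + (i : ZMod p) * d)) (ap z d (c + 1)) := by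
  intro a ha b hb w hw
  rw [Finset.mem_sdiff, mem_partners] at hb
  obtain ⟨j, hj, rfl⟩ := mem_ap.1 hw
  by_cases hji : j = i
  · subst hji
    intro h0
    apply hb.2
    refine ⟨hb.1, ?_⟩
    rwa [show -(b + (z + (j : ZMod p) * d)) = a by linear_combination -h0]
  · exact h a ha b hb.1 j (by omega) hji

lemma card_sdiff_partners (A B : Finset (ZMod p)) (z : ZMod p) :
    (B \ partners B A z).card + (partners A B z).card = B.card := by
  have hs : partners B A z ⊆ B := Finset.filter_subset _ _
  rw [Finset.card_sdiff_of_subset hs, card_partners_comm A B]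
  have := Finset.card_le_card hs
  omega

lemma TrioExcept.add_notMem {A B : Finset (ZMod p)} {z d : ZMod p} {c i : ℕ}
    (h : TrioExcept A B z d c i) (hi : i ≤ c) {s : ZMod p}
    (hs : s ∈ partners A B (z + (i : ZMod p) * d)) {t : ℕ} (ht : 1 ≤ t) (hti : t ≤ i) :
    s + (t : ZMod p) * d ∉ A := by
  intro hmem
  rw [mem_partners] at hs
  apply h _ hmem _ hs.2 (i - t) (by omega) (by omega)
  rw [Nat.cast_sub hti]; ring

lemma TrioExcept.sub_notMem {A B : Finset (ZMod p)} {z d : ZMod p} {c i : ℕ}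
    (h : TrioExcept A B z d c i) (hi : i + 1 ≤ c) {s : ZMod p}
    (hs : s ∈ partners A B (z + (i : ZMod p) * d)) : s - d ∉ A := by
  intro hmem
  rw [mem_partners] at hs
  apply h _ hmem _ hs.2 (i + 1) (by omega) (by omega)
  push_cast; ring

lemma TrioExcept.card_partners_le_one {A B : Finset (ZMod p)} {z d : ZMod p} {c i : ℕ}
    (h : TrioExcept A B z d c i) (hd : d ≠ 0) (hi : 2 ≤ i) (hic : i + 1 ≤ c)
    (hA : 3 ≤ A.card) (hs : A.card + B.card + c = p)
    (hlt : (partners A B (z + (i : ZMod p) * d)).card < B.card) :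
    (partners A B (z + (i : ZMod p) * d)).card ≤ 1 := by
  set S := partners A B (z + (i : ZMod p) * d) with hS
  by_contra hσ
  have hcB := card_sdiff_partners A B (z + (i : ZMod p) * d)
  rw [← hS] at hcB
  have hSA : S ⊆ A := Finset.filter_subset _ _
  have hAne : A.Nonempty := Finset.card_pos.1 (by omega)
  obtain ⟨m, rfl⟩ : ∃ m, c = m + 1 := ⟨c - 1, by omega⟩
  have h1 := h.trio_sdiff.card_union_union_le (n := m) hd (by omega) (by omega) hAne
    (Finset.card_pos.1 (by omega))
  have hone : ∀ s ∈ S, s + d ∉ A := by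
    intro s hs
    have := h.add_notMem (by omega) hs (t := 1) le_rfl (by omega)
    simpa using this
  have htwo : ∀ s ∈ S, s + d + d ∉ A := by
    intro s hs
    have := h.add_notMem (by omega) hs (t := 2) (by omega) hi
    rwa [show s + ((2 : ℕ) : ZMod p) * d = s + d + d by push_cast; ring] at this
  have hSD : S ⊆ A \ inter A d := by
    intro s hs
    rw [Finset.mem_sdiff, mem_inter]
    exact ⟨hSA hs, fun h => hone s hs h.2⟩
  have hSD' : S.image (· + d) ⊆ union A d \ inter (union A d) d := by
    intro y hy
    obtain ⟨s, hs, rfl⟩ := Finset.mem_image.1 hy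
    rw [Finset.mem_sdiff, mem_inter, mem_union, mem_union]
    refine ⟨Or.inr (by simpa using hSA hs), fun h => ?_⟩
    rcases h.2 with h | h
    · exact htwo s hs h
    · exact hone s hs (by simpa using h)
  have hc1 := Finset.card_le_card hSD
  have hc2 := Finset.card_le_card hSD'
  rw [Finset.card_sdiff_of_subset (inter_subset _ _)] at hc1 hc2
  rw [Finset.card_image_of_injective _ (add_left_injective d)] at hc2
  have h2 := card_union_add_card_inter A d
  have h3 := card_union_add_card_inter (union A d) d
  have h5 := card_inter_le A d
  have h6 := card_inter_le (union A d) d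
  have heq : S = A \ inter A d := by
    apply Finset.eq_of_subset_of_card_le hSD
    rw [Finset.card_sdiff_of_subset (inter_subset _ _)]
    omega
  have hclosed : ∀ x ∈ A \ S, x + d ∈ A \ S := by
    intro x hx
    rw [Finset.mem_sdiff] at hx
    have hxd : x + d ∈ A := by
      by_contra hc
      apply hx.2
      rw [heq, Finset.mem_sdiff, mem_inter]
      exact ⟨hx.1, fun h => hc h.2⟩
    rw [Finset.mem_sdiff]
    refine ⟨hxd, fun hxs => h.sub_notMem hic hxs ?_⟩
    simpa using hx.1
  have hcard : (A \ S).card = A.card - S.card := Finset.card_sdiff_of_subset hSA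
  by_cases hne : (A \ S).Nonempty
  · have := eq_univ_of_forall_add_mem hd hne hclosed
    rw [this, card_univ'] at hcard
    omega
  · rw [Finset.not_nonempty_iff_eq_empty] at hne
    rw [hne, Finset.card_empty] at hcard
    omega

lemma TrioExcept.exists_subset_ap {A B : Finset (ZMod p)} {z d : ZMod p} {c i : ℕ}
    (h : TrioExcept A B z d c i) (hd : d ≠ 0) (hi : c ≤ 2 * i) (hic : i ≤ c)
    (hc : 3 ≤ c) (hA : 3 ≤ A.card) (hB : 3 ≤ B.card) (hAB : 7 ≤ A.card + B.card)
    (hs : A.card + B.card + c = p) : ∃ s, A ⊆ ap s d (A.card + 1) := by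
  have hAne : A.Nonempty := Finset.card_pos.1 (by omega)
  rcases hic.eq_or_lt with rfl | hic
  · refine Trio.exists_subset_ap_succ (B := B) (z := z) (n := i) hd hc (by omega) hAne
      (Finset.card_pos.1 (by omega)) ?_ (by omega)
    intro a ha b hb w hw
    obtain ⟨j, hj, rfl⟩ := mem_ap.1 hw
    exact h a ha b hb j (by omega) (by omega)
  · set S := partners A B (z + (i : ZMod p) * d) with hS
    have hcB := card_sdiff_partners A B (z + (i : ZMod p) * d)
    rw [← hS] at hcB
    by_cases hσ : S.card ≤ 1
    · exact h.trio_sdiff.exists_subset_ap_succ hd (by omega) (by omega) hAne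
        (Finset.card_pos.1 (by omega)) (by omega)
    exfalso
    have h1 := mt (h.card_partners_le_one hd (by omega) hic hA hs) hσ
    have hσ' : ¬ (partners B A (z + (i : ZMod p) * d)).card ≤ 1 := by
      rwa [card_partners_comm B A]
    have h2 := mt (h.swap.card_partners_le_one hd (by omega) hic hB (by omega)) hσ'
    rw [card_partners_comm B A] at h2
    have hSA : S ⊆ A := Finset.filter_subset _ _
    have h3 := Finset.card_le_card hSA
    rw [← hS] at h1 h2
    have hSeq : S = A := Finset.eq_of_subset_of_card_le hSA (by omega)
    have hAB' : A.card = B.card := by omega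
    have hinj : Set.InjOn (fun q : ZMod p × ℕ => q.1 + (q.2 : ZMod p) * d)
        (A ×ˢ Finset.range (i + 1) : Finset (ZMod p × ℕ)) := by
      have key : ∀ s ∈ A, ∀ s' ∈ A, ∀ t t' : ℕ, t ≤ t' → t' ≤ i →
          s + (t : ZMod p) * d = s' + (t' : ZMod p) * d → t = t' := by
        intro s hs s' hs' t t' htt ht' he
        by_contra hne
        rw [← hSeq] at hs'
        apply h.add_notMem hic.le hs' (t := t' - t) (by omega) (by omega)
        rw [Nat.cast_sub htt]
        rwa [show s' + ((t' : ZMod p) - t) * d = s by linear_combination -he]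
      rintro ⟨s, t⟩ hq ⟨s', t'⟩ hq' he
      simp only [Finset.coe_product, Set.mem_prod, Finset.mem_coe, Finset.mem_range] at hq hq' he
      have htt : t = t' := by
        rcases le_total t t' with hle | hle
        · exact key s hq.1 s' hq'.1 t t' hle (by omega) he
        · exact (key s' hq'.1 s hq.1 t' t hle (by omega) he.symm).symm
      subst htt
      rw [add_left_injective _ he]
    have hcard := Finset.card_le_univ
      ((A ×ˢ Finset.range (i + 1)).image fun q : ZMod p × ℕ => q.1 + (q.2 : ZMod p) * d)
    rw [Finset.card_image_of_injOn hinj, Finset.card_product, Finset.card_range, ZMod.card]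
      at hcard
    have ha4 : 4 ≤ A.card := by omega
    have hi2 : i = 2 := by nlinarith
    subst hi2
    have : A.card = 4 := by omega
    have : c = 4 := by omega
    have hp12 : p = 12 := by omega
    have hprime : p.Prime := Fact.out
    rw [hp12] at hprime
    norm_num at hprime

/-- `X` is contained in an arithmetic progression with difference `d` and one more term. -/
def IsAlmostAP (d : ZMod p) (X : Finset (ZMod p)) : Prop := ∃ s, X ⊆ ap s d (X.card + 1)

lemma IsAlmostAP.neg {d : ZMod p} {X : Finset (ZMod p)} (h : IsAlmostAP d X) :
    IsAlmostAP (-d) X := by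
  obtain ⟨s, hs⟩ := h
  exact ⟨_, hs.trans ap_neg⟩

/-- Being almost a progression passes from one set of an extremal triple to another one. -/
lemma Trio.isAlmostAP {A B C : Finset (ZMod p)} {d : ZMod p} (h : Trio A B C) (hd : d ≠ 0)
    (hA : 3 ≤ A.card) (hB : 3 ≤ B.card) (hC : 3 ≤ C.card) (hAB : 7 ≤ A.card + B.card)
    (hs : A.card + B.card + C.card = p) (hCd : IsAlmostAP d C) : IsAlmostAP d A := by
  have key : ∀ d : ZMod p, d ≠ 0 → ∀ z : ZMod p, ∀ i ≤ C.card, C.card ≤ 2 * i →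
      (∀ j ≤ C.card, j ≠ i → z + (j : ZMod p) * d ∈ C) → IsAlmostAP d A := by
    intro d hd z i hi hi2 hz
    refine TrioExcept.exists_subset_ap (B := B) (z := z) (i := i) (c := C.card) ?_ hd hi2 hi hC hA
      hB hAB hs
    intro a ha b hb j hj hji
    exact h a ha b hb _ (hz j hj hji)
  obtain ⟨z, hz⟩ := hCd
  have hcard : (ap z d (C.card + 1) \ C).card = 1 := by
    rw [Finset.card_sdiff_of_subset hz, card_ap hd (by omega)]; omega
  obtain ⟨w, hw⟩ := Finset.card_eq_one.1 hcard
  have hwm : w ∈ ap z d (C.card + 1) \ C := by rw [hw]; simp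
  obtain ⟨i, hi, rfl⟩ := mem_ap.1 (Finset.mem_sdiff.1 hwm).1
  have hmem : ∀ j ≤ C.card, j ≠ i → z + (j : ZMod p) * d ∈ C := by
    intro j hj hji
    by_contra hc
    have : z + (j : ZMod p) * d ∈ ap z d (C.card + 1) \ C :=
      Finset.mem_sdiff.2 ⟨mem_ap.2 ⟨j, by omega, rfl⟩, hc⟩
    rw [hw, Finset.mem_singleton] at this
    exact hji (natCast_mul_inj hd (by omega) (by omega) (add_left_cancel this))
  by_cases h2 : C.card ≤ 2 * i
  · exact key d hd z i (by omega) h2 hmem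
  · have := key (-d) (neg_ne_zero.2 hd) (z + (C.card : ZMod p) * d) (C.card - i) (by omega)
      (by omega) (by
        intro j hj hji
        have := hmem (C.card - j) (by omega) (by omega)
        rw [Nat.cast_sub hj] at this
        rwa [show z + (C.card : ZMod p) * d + (j : ZMod p) * -d
          = z + ((C.card : ZMod p) - j) * d by ring])
    have := this.neg
    rwa [neg_neg] at this

lemma of_sorted {p : ℕ} {R : Finset (ZMod p) → Finset (ZMod p) → Finset (ZMod p) → Prop}
    (hswap : ∀ A B C, R A B C → R B A C) (hrot : ∀ A B C, R A B C → R B C A)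
    (A B C : Finset (ZMod p))
    (h : ∀ X Y Z : Finset (ZMod p), X.card ≤ Y.card → Y.card ≤ Z.card → X.card ≤ A.card →
      (X.card = A.card → Y.card ≤ B.card) → R X Y Z) : R A B C := by
  rcases le_total A.card B.card with h1 | h1 <;> rcases le_total B.card C.card with h2 | h2 <;>
    rcases le_total A.card C.card with h3 | h3
  · exact h A B C h1 h2 (by omega) (by omega)
  · exact h A B C h1 h2 (by omega) (by omega)
  · exact hrot _ _ _ (hswap _ _ _ (h A C B h3 h2 (by omega) (by omega)))
  · exact hrot _ _ _ (h C A B h3 h1 (by omega) (by omega))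
  · exact hswap _ _ _ (h B A C h1 h3 (by omega) (by omega))
  · exact hrot _ _ _ (hrot _ _ _ (h B C A h2 h3 (by omega) (by omega)))
  · exact hswap _ _ _ (hrot _ _ _ (h C B A h2 h1 (by omega) (by omega)))
  · exact hswap _ _ _ (hrot _ _ _ (h C B A h2 h1 (by omega) (by omega)))

/-- Induction on the smallest size and then on the second smallest size of a triple of sets. -/
lemma trio_induction {p : ℕ} {R : Finset (ZMod p) → Finset (ZMod p) → Finset (ZMod p) → Prop}
    (hswap : ∀ A B C, R A B C → R B A C) (hrot : ∀ A B C, R A B C → R B C A)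
    (step : ∀ A B C, A.card ≤ B.card → B.card ≤ C.card →
      (∀ A' B' C', A'.card < A.card ∨ (A'.card = A.card ∧ B'.card < B.card) → R A' B' C') →
      R A B C) (A B C : Finset (ZMod p)) : R A B C := by
  have main : ∀ n m : ℕ, ∀ A B C : Finset (ZMod p), A.card ≤ B.card → B.card ≤ C.card →
      A.card = n → B.card = m → R A B C := by
    intro n
    induction n using Nat.strong_induction_on with
    | _ n ihn =>
    intro m
    induction m using Nat.strong_induction_on with
    | _ m ihm =>
    intro A B C hAB hBC hn hm
    apply step A B C hAB hBC
    intro A' B' C' h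
    refine of_sorted hswap hrot A' B' C' fun X Y Z hXY hYZ hX hY => ?_
    rcases lt_or_ge X.card n with hlt | hge
    · exact ihn _ hlt _ X Y Z hXY hYZ rfl rfl
    · exact ihm _ (by omega) X Y Z hXY hYZ (by omega) rfl
  exact of_sorted hswap hrot A B C fun X Y Z hXY hYZ _ _ => main _ _ X Y Z hXY hYZ rfl rfl

/-- The elements of `A` that are in the translate of `B` by `e`. -/
def cap (A B : Finset (ZMod p)) (e : ZMod p) : Finset (ZMod p) := A.filter fun x => x - e ∈ B

/-- The union of `B` and the translate of `A` by `-e`. -/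
def cup (A B : Finset (ZMod p)) (e : ZMod p) : Finset (ZMod p) := B ∪ A.image fun x => x - e

lemma mem_cap {A B : Finset (ZMod p)} {e x : ZMod p} : x ∈ cap A B e ↔ x ∈ A ∧ x - e ∈ B := by
  simp [cap]

lemma Trio.cap_cup {A B C : Finset (ZMod p)} (h : Trio A B C) (e : ZMod p) :
    Trio (cap A B e) (cup A B e) C := by
  intro a ha b hb c hc
  rw [mem_cap] at ha
  rw [cup, Finset.mem_union, Finset.mem_image] at hb
  rcases hb with hb | ⟨a', ha', rfl⟩
  · exact h a ha.1 b hb c hc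
  · have := h a' ha' _ ha.2 c hc
    rwa [show a + (a' - e) + c = a' + (a - e) + c by ring]

lemma card_cap_add_card_cup (A B : Finset (ZMod p)) (e : ZMod p) :
    (cap A B e).card + (cup A B e).card = A.card + B.card := by
  have hinj : Function.Injective fun x : ZMod p => x - e := sub_left_injective
  have h1 := Finset.card_union_add_card_inter B (A.image fun x => x - e)
  rw [Finset.card_image_of_injective _ hinj] at h1
  have h2 : B ∩ A.image (fun x => x - e) = (cap A B e).image fun x => x - e := by
    ext x
    simp only [Finset.mem_inter, Finset.mem_image, mem_cap]
    constructor
    · rintro ⟨hx, a, ha, rfl⟩; exact ⟨a, ⟨ha, hx⟩, rfl⟩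
    · rintro ⟨a, ⟨ha, hx⟩, rfl⟩; exact ⟨hx, a, ha, rfl⟩
  rw [h2, Finset.card_image_of_injective _ hinj] at h1
  rw [cup]; omega

lemma card_cap_le (A B : Finset (ZMod p)) (e : ZMod p) : (cap A B e).card ≤ A.card :=
  Finset.card_le_card (Finset.filter_subset _ _)

/-- The elements whose sum with every element of `A` is in `B`. -/
def residual (A B : Finset (ZMod p)) : Finset (ZMod p) :=
  Finset.univ.filter fun y => ∀ x ∈ A, x + y ∈ B

lemma mem_residual {A B : Finset (ZMod p)} {y : ZMod p} :
    y ∈ residual A B ↔ ∀ x ∈ A, x + y ∈ B := by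
  simp [residual]

lemma card_image_neg_compl (B : Finset (ZMod p)) : (Bᶜ.image (-·)).card + B.card = p := by
  rw [Finset.card_image_of_injective _ neg_injective, Finset.card_compl, ZMod.card]
  have := Finset.card_le_univ B
  rw [ZMod.card] at this
  omega

lemma trio_residual (A B : Finset (ZMod p)) : Trio A (residual A B) (Bᶜ.image (-·)) := by
  intro a ha y hy c hc
  obtain ⟨c', hc', rfl⟩ := Finset.mem_image.1 hc
  rw [Finset.mem_compl] at hc'
  intro h0
  apply hc'
  have := mem_residual.1 hy a ha
  rwa [show a + y = c' by linear_combination h0] at this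

lemma card_inter_le_card_residual {A B : Finset (ZMod p)} {g u : ZMod p}
    (h : ∀ x ∈ inter B g, x - u ∈ residual A B) : (inter B g).card ≤ (residual A B).card :=
  Finset.card_le_card_of_injOn (fun x => x - u) h fun _ _ _ _ hxy => sub_left_injective hxy

lemma card_residual_le_card_inter {A B : Finset (ZMod p)} {u v : ZMod p} (hu : u ∈ A)
    (hv : v ∈ A) : (residual A B).card ≤ (inter B (v - u)).card := by
  apply Finset.card_le_card_of_injOn (fun y => u + y)
  · intro y hy
    rw [Finset.mem_coe, mem_residual] at hy
    rw [Finset.mem_coe, mem_inter]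
    exact ⟨hy u hu, by rw [show u + y + (v - u) = v + y by ring]; exact hy v hv⟩
  · intro _ _ _ _ hxy
    exact add_right_injective u hxy

lemma image_add_inter_image_add (B : Finset (ZMod p)) (u v : ZMod p) :
    B.image (· + u) ∩ B.image (· + v) = (inter B (v - u)).image (· + v) := by
  ext x
  simp only [Finset.mem_inter, Finset.mem_image, mem_inter]
  constructor
  · rintro ⟨⟨b, hb, rfl⟩, b', hb', h⟩
    refine ⟨b', ⟨hb', ?_⟩, h⟩
    rwa [show b' + (v - u) = b by linear_combination h]
  · rintro ⟨b, ⟨hb, hb'⟩, rfl⟩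
    exact ⟨⟨_, hb', by ring⟩, b, hb, rfl⟩

lemma card_triple_add (B : Finset (ZMod p)) (u v w : ZMod p) :
    (({u, v, w} : Finset (ZMod p)) + B).card + (inter B (v - u)).card + (inter B (w - u)).card
      + (inter B (w - v)).card
      = 3 * B.card + (residual {-u, -v, -w} B).card := by
  have hI : ∀ t : ZMod p, ∀ X : Finset (ZMod p), (X.image (· + t)).card = X.card := fun t X =>
    Finset.card_image_of_injective _ (add_left_injective t)
  set X := B.image (· + u) with hX
  set Y := B.image (· + v) with hY
  set Z := B.image (· + w) with hZ
  have h0 : ({u, v, w} : Finset (ZMod p)) + B = X ∪ Y ∪ Z := by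
    ext x
    simp only [Finset.mem_add, Finset.mem_union, hX, hY, hZ, Finset.mem_image, Finset.mem_insert,
      Finset.mem_singleton, exists_eq_or_imp, exists_eq_left, add_comm, or_assoc,
      and_or_left, exists_or]
  have h1 := Finset.card_union_add_card_inter (X ∪ Y) Z
  have h2 := Finset.card_union_add_card_inter X Y
  have h3 := Finset.card_union_add_card_inter (X ∩ Z) (Y ∩ Z)
  have h4 : X ∩ Z ∩ (Y ∩ Z) = residual {-u, -v, -w} B := by
    ext x
    have : ∀ t : ZMod p, (∃ a ∈ B, a + t = x) ↔ -t + x ∈ B := fun t =>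
      ⟨fun ⟨a, ha, h⟩ => by rwa [show -t + x = a by linear_combination -h],
        fun h => ⟨_, h, by ring⟩⟩
    simp only [Finset.mem_inter, hX, hY, hZ, Finset.mem_image, this, mem_residual,
      Finset.mem_insert, Finset.mem_singleton, forall_eq_or_imp, forall_eq]
    tauto
  rw [← Finset.union_inter_distrib_right, h4] at h3
  have hI2 : ∀ s t : ZMod p, (B.image (· + s) ∩ B.image (· + t)).card = (inter B (t - s)).card :=
    fun s t => by rw [image_add_inter_image_add, hI]
  have hXY : (X ∩ Y).card = (inter B (v - u)).card := hI2 u v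
  have hXZ : (X ∩ Z).card = (inter B (w - u)).card := hI2 u w
  have hYZ : (Y ∩ Z).card = (inter B (w - v)).card := hI2 v w
  have hXc : X.card = B.card := hI u B
  have hYc : Y.card = B.card := hI v B
  have hZc : Z.card = B.card := hI w B
  rw [h0]
  omega

lemma three_mul_card_le {A : Finset (ZMod p)} (B : Finset (ZMod p)) {u v w : ZMod p} (hu : u ∈ A)
    (hv : v ∈ A) (hw : w ∈ A) :
    3 * B.card ≤ (A + B).card + (inter B (v - u)).card + (inter B (w - u)).card
      + (inter B (w - v)).card := by
  have h1 := card_triple_add B u v w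
  have h2 : (({u, v, w} : Finset (ZMod p)) + B).card ≤ (A + B).card := by
    apply Finset.card_le_card
    apply Finset.add_subset_add_right
    intro x hx
    simp only [Finset.mem_insert, Finset.mem_singleton] at hx
    rcases hx with rfl | rfl | rfl <;> assumption
  omega

/-- Vosper's theorem, for triples of sets. -/
def VosperConclusion (A B C : Finset (ZMod p)) : Prop :=
  ∃ d : ZMod p, d ≠ 0 ∧ (∃ s, A ⊆ ap s d A.card) ∧ (∃ s, B ⊆ ap s d B.card) ∧
    ∃ s, C ⊆ ap s d C.card

lemma Trio.vosperConclusion {A B C : Finset (ZMod p)} (h : Trio A B C) (hA : 2 ≤ A.card)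
    (hB : 2 ≤ B.card) (hC : 2 ≤ C.card) (hs : A.card + B.card + C.card = p + 1)
    {d s : ZMod p} (hd : d ≠ 0) (hAs : A ⊆ ap s d A.card) : VosperConclusion A B C := by
  have hAeq := ap_subset_of_subset_ap hd (by omega) hAs
  have hBne : B.Nonempty := Finset.card_pos.1 (by omega)
  have hCne : C.Nonempty := Finset.card_pos.1 (by omega)
  refine ⟨d, hd, ⟨s, hAs⟩, ?_, ?_⟩
  · refine Trio.exists_subset_ap (B := C) (z := s) (n := A.card) hd hA (by omega) hBne hCne ?_
      (by omega)
    rw [← hAeq]; exact h.rotate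
  · refine Trio.exists_subset_ap (B := B) (z := s) (n := A.card) hd hA (by omega) hCne hBne ?_
      (by omega)
    rw [← hAeq]; exact h.rotate.swap

theorem Trio.vosper {A B C : Finset (ZMod p)} (h : Trio A B C) (hA : 2 ≤ A.card)
    (hB : 2 ≤ B.card) (hC : 2 ≤ C.card) (hs : A.card + B.card + C.card = p + 1) :
    VosperConclusion A B C := by
  revert h hA hB hC hs
  refine trio_induction (R := fun A B C => Trio A B C → 2 ≤ A.card → 2 ≤ B.card → 2 ≤ C.card →
    A.card + B.card + C.card = p + 1 → VosperConclusion A B C) ?_ ?_ ?_ A B C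
  · intro A B C ih h hB hA hC hs
    obtain ⟨d, hd, h1, h2, h3⟩ := ih h.swap hA hB hC (by omega)
    exact ⟨d, hd, h2, h1, h3⟩
  · intro A B C ih h hB hC hA hs
    obtain ⟨d, hd, h1, h2, h3⟩ := ih h.rotate.rotate hA hB hC (by omega)
    exact ⟨d, hd, h2, h3, h1⟩
  intro A B C hAB hBC ih h hA hB hC hs
  by_contra hno
  have nA : ∀ d ≠ 0, ∀ s, ¬ A ⊆ ap s d A.card := fun d hd s hAs =>
    hno (h.vosperConclusion hA hB hC hs hd hAs)
  have nC : ∀ d ≠ 0, ∀ s, ¬ C ⊆ ap s d C.card := fun d hd s hCs => by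
    obtain ⟨d, hd, h1, h2, h3⟩ :=
      h.rotate.rotate.vosperConclusion hC hA hB (by omega) hd hCs
    exact hno ⟨d, hd, h2, h3, h1⟩
  have hAne : A.Nonempty := Finset.card_pos.1 (by omega)
  have hBne : B.Nonempty := Finset.card_pos.1 (by omega)
  have hCne : C.Nonempty := Finset.card_pos.1 (by omega)
  have ha3 : 3 ≤ A.card := by
    by_contra hlt
    obtain ⟨u, v, huv, hAuv⟩ := Finset.card_eq_two.1 (show A.card = 2 by omega)
    apply nA (v - u) (sub_ne_zero.2 huv.symm) u
    rw [show A.card = 2 by omega, hAuv]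
    exact ap_pair
  have hT1 : ∀ g, (inter A g).Nonempty →
      (inter A g).card + B.card ≤ A.card + (inter B g).card := by
    intro g hg
    have h1 := (h.inter_union g).card_le hg (union_nonempty hBne) hCne
    have h2 := card_union_add_card_inter B g
    omega
  have hT2 : ∀ g, (inter A g).Nonempty →
      A.card + (inter B g).card ≤ (inter A g).card + B.card := by
    intro g hg
    have h0 := hT1 g hg
    have h3 := hg.card_pos
    have h1 := (h.union_inter g).card_le (union_nonempty hAne) (Finset.card_pos.1 (by omega)) hCne
    have h2 := card_union_add_card_inter A g
    omega
  have hα : ∀ g ≠ 0, (inter A g).card ≤ 1 := by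
    intro g hg
    by_contra hlt
    have hne : (inter A g).Nonempty := Finset.card_pos.1 (by omega)
    have h1 := hT1 g hne
    have h2 := hT2 g hne
    have h3 := card_union_add_card_inter B g
    have h4 := card_le_card_union B g
    obtain ⟨d, hd, -, -, s, hCs⟩ := ih _ _ _ (Or.inl (card_inter_lt hg hAne (by omega)))
      (h.inter_union g) (by omega) (by omega) hC (by omega)
    exact nC d hd s hCs
  have hcap : ∀ e, 2 ≤ (cap A B e).card → (cap A B e).card = A.card := by
    intro e he
    by_contra hne
    have h1 := card_cap_le A B e
    have h2 := card_cap_add_card_cup A B e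
    obtain ⟨d, hd, -, -, s, hCs⟩ := ih _ _ _ (Or.inl (by omega)) (h.cap_cup e) he (by omega) hC
      (by omega)
    exact nC d hd s hCs
  obtain ⟨u, hu, v, hv, w, hw, huv, huw, hvw⟩ := Finset.two_lt_card.1 (show 2 < A.card by omega)
  have hone : (inter A (v - u)).card = 1 := by
    have h1 := hα (v - u) (sub_ne_zero.2 huv.symm)
    have h2 : 0 < (inter A (v - u)).card :=
      Finset.card_pos.2 ⟨u, mem_inter.2 ⟨hu, by simpa using hv⟩⟩
    omega
  have hne : (inter A (v - u)).Nonempty := Finset.card_pos.1 (by omega)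
  have hβ1 := hT1 _ hne
  have hβ2 := hT2 _ hne
  have hy : (inter B (v - u)).card ≤ (residual A B).card := by
    apply card_inter_le_card_residual (u := u)
    intro x hx
    rw [mem_inter] at hx
    have hr : 2 ≤ (cap A B (u - x)).card := by
      rw [← Finset.card_pair huv]
      apply Finset.card_le_card
      intro t ht
      rw [Finset.mem_insert, Finset.mem_singleton] at ht
      rw [mem_cap]
      rcases ht with rfl | rfl
      · exact ⟨hu, by simpa using hx.1⟩
      · refine ⟨hv, ?_⟩
        rw [show t - (u - x) = x + (t - u) by ring]
        exact hx.2
    have heq : cap A B (u - x) = A :=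
      Finset.eq_of_subset_of_card_le (Finset.filter_subset _ _) (hcap _ hr).ge
    rw [mem_residual]
    intro t ht
    rw [← heq, mem_cap] at ht
    rw [show t + (x - u) = t - (u - x) by ring]
    exact ht.2
  have hC' := card_image_neg_compl B
  have hyne : (residual A B).Nonempty := Finset.card_pos.1 (by omega)
  have hres := trio_residual A B
  have h5 := hres.card_le hAne hyne (Finset.card_pos.1 (by omega))
  by_cases hy2 : 2 ≤ (residual A B).card
  · obtain ⟨d, hd, ⟨s, hAs⟩, -, -⟩ := ih _ _ _ (Or.inr ⟨rfl, by omega⟩) hres hA hy2 (by omega)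
      (by omega)
    exact nA d hd s hAs
  · obtain ⟨t, ht⟩ := hyne
    have hsub : (A + A).card ≤ (A + B).card := by
      have : (A + A).image (· + t) ⊆ A + B := by
        intro x hx
        obtain ⟨z, hz, rfl⟩ := Finset.mem_image.1 hx
        obtain ⟨a, ha, b, hb, rfl⟩ := Finset.mem_add.1 hz
        rw [add_assoc]
        exact Finset.add_mem_add ha (mem_residual.1 ht b hb)
      have := Finset.card_le_card this
      rwa [Finset.card_image_of_injective _ (add_left_injective t)] at this
    have h6 := h.card_add_le
    have h7 := three_mul_card_le A hu hv hw
    have h8 := hα (v - u) (sub_ne_zero.2 huv.symm)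
    have h9 := hα (w - u) (sub_ne_zero.2 huw.symm)
    have h10 := hα (w - v) (sub_ne_zero.2 hvw.symm)
    omega

/-- `X` is not almost an arithmetic progression. -/
def Irregular (X : Finset (ZMod p)) : Prop := ∀ d : ZMod p, d ≠ 0 → ¬ IsAlmostAP d X

lemma Irregular.neg {X : Finset (ZMod p)} (h : Irregular X) : Irregular (-X) := by
  rintro d hd ⟨s, hs⟩
  refine h (-d) (neg_ne_zero.2 hd) ⟨-s, fun x hx => ?_⟩
  rw [Finset.card_neg] at hs
  obtain ⟨j, hj, hj'⟩ := mem_ap.1 (hs (Finset.neg_mem_neg hx))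
  exact mem_ap.2 ⟨j, hj, by linear_combination -hj'⟩

lemma Trio.card_le_of_irregular {A B C : Finset (ZMod p)} (h : Trio A B C) (hA : 2 ≤ A.card)
    (hB : 2 ≤ B.card) (hC : 2 ≤ C.card) (hC' : Irregular C) : A.card + B.card + C.card ≤ p := by
  have h1 := h.card_le (Finset.card_pos.1 (by omega)) (Finset.card_pos.1 (by omega))
    (Finset.card_pos.1 (by omega))
  by_contra hlt
  obtain ⟨d, hd, -, -, s, hs⟩ := h.vosper hA hB hC (by omega)
  exact hC' d hd ⟨s, hs.trans (ap_mono (by omega))⟩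

/-- The hypotheses of the theorem, for triples of sets. -/
structure Extremal (A B C : Finset (ZMod p)) : Prop where
  trio : Trio A B C
  three_le_left : 3 ≤ A.card
  three_le_mid : 3 ≤ B.card
  three_le_right : 3 ≤ C.card
  left_mid : 7 ≤ A.card + B.card
  left_right : 7 ≤ A.card + C.card
  mid_right : 7 ≤ B.card + C.card
  card_eq : A.card + B.card + C.card = p

lemma Extremal.swap {A B C : Finset (ZMod p)} (h : Extremal A B C) : Extremal B A C := by
  obtain ⟨h1, h2, h3, h4, h5, h6, h7, h8⟩ := h
  exact ⟨h1.swap, h3, h2, h4, by omega, by omega, by omega, by omega⟩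

lemma Extremal.rotate {A B C : Finset (ZMod p)} (h : Extremal A B C) : Extremal B C A := by
  obtain ⟨h1, h2, h3, h4, h5, h6, h7, h8⟩ := h
  exact ⟨h1.rotate, h3, h4, h2, by omega, by omega, by omega, by omega⟩

/-- The conclusion of the theorem, for triples of sets. -/
def AllAlmostAP (A B C : Finset (ZMod p)) : Prop :=
  ∃ d : ZMod p, d ≠ 0 ∧ IsAlmostAP d A ∧ IsAlmostAP d B ∧ IsAlmostAP d C

lemma AllAlmostAP.swap {A B C : Finset (ZMod p)} (h : AllAlmostAP A B C) :
    AllAlmostAP B A C := by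
  obtain ⟨d, hd, h1, h2, h3⟩ := h
  exact ⟨d, hd, h2, h1, h3⟩

lemma AllAlmostAP.rotate {A B C : Finset (ZMod p)} (h : AllAlmostAP A B C) :
    AllAlmostAP B C A := by
  obtain ⟨d, hd, h1, h2, h3⟩ := h
  exact ⟨d, hd, h2, h3, h1⟩

lemma Extremal.irregular {A B C : Finset (ZMod p)} (h : Extremal A B C)
    (hno : ¬ AllAlmostAP A B C) : Irregular C := by
  intro d hd hC
  have h' := h.swap
  exact hno ⟨d, hd,
    h.trio.isAlmostAP hd h.three_le_left h.three_le_mid h.three_le_right h.left_mid h.card_eq hC,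
    h'.trio.isAlmostAP hd h'.three_le_left h'.three_le_mid h'.three_le_right h'.left_mid
      h'.card_eq hC, hC⟩

/-- An extremal triple that is not made of almost progressions, with first set of minimal size. -/
structure Critical (A B C : Finset (ZMod p)) : Prop where
  extremal : Extremal A B C
  irregular_left : Irregular A
  irregular_mid : Irregular B
  irregular_right : Irregular C
  left_le_mid : A.card ≤ B.card
  left_le_right : A.card ≤ C.card
  minimal : ∀ A' B' C' : Finset (ZMod p), A'.card < A.card → Extremal A' B' C' →
    AllAlmostAP A' B' C'

section Critical

variable {A B C : Finset (ZMod p)}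

lemma Critical.symm (h : Critical A B C) : Critical A C B :=
  ⟨h.extremal.rotate.rotate.swap, h.irregular_left, h.irregular_right, h.irregular_mid,
    h.left_le_right, h.left_le_mid, h.minimal⟩

lemma Critical.card_inter_mid_ge (h : Critical A B C) {g : ZMod p}
    (hg : 2 ≤ (inter A g).card) : (inter A g).card + B.card ≤ A.card + (inter B g).card := by
  obtain ⟨h1, h2, h3, h4, h5, h6, h7, h8⟩ := h.extremal
  have h9 := card_le_card_union B g
  have h10 := (h1.inter_union g).card_le_of_irregular hg (by omega) (by omega) h.irregular_right
  have h11 := card_union_add_card_inter B g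
  omega

lemma Critical.card_inter_mid_le (h : Critical A B C) {g : ZMod p}
    (hg : 2 ≤ (inter B g).card) : A.card + (inter B g).card ≤ (inter A g).card + B.card := by
  obtain ⟨h1, h2, h3, h4, h5, h6, h7, h8⟩ := h.extremal
  have h9 := card_le_card_union A g
  have h10 := (h1.union_inter g).card_le_of_irregular (by omega) hg (by omega) h.irregular_right
  have h11 := card_union_add_card_inter A g
  omega

lemma Critical.card_inter_le_two (h : Critical A B C) {g : ZMod p} (hg : g ≠ 0) :
    (inter A g).card ≤ 2 := by
  obtain ⟨h1, h2, h3, h4, h5, h6, h7, h8⟩ := h.extremal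
  have h9 := h.left_le_mid
  have h10 := h.left_le_right
  by_contra hlt
  have h11 := h.card_inter_mid_ge (g := g) (by omega)
  have h12 := h.card_inter_mid_le (g := g) (by omega)
  have h13 := card_union_add_card_inter B g
  have h14 := card_le_card_union B g
  have h15 := card_inter_lt hg (Finset.card_pos.1 (show 0 < A.card by omega)) (by omega)
  obtain ⟨d, hd, -, -, hC⟩ := h.minimal (inter A g) (union B g) C h15
    ⟨h1.inter_union g, by omega, by omega, by omega, by omega, by omega, by omega, by omega⟩
  exact h.irregular_right d hd hC

lemma Critical.card_inter_mid_of_two (h : Critical A B C) {g : ZMod p}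
    (hg : (inter A g).card = 2) : A.card + (inter B g).card = B.card + 2 := by
  have h9 := h.left_le_mid
  have h11 := h.card_inter_mid_ge (g := g) (by omega)
  have h12 := h.card_inter_mid_le (g := g) (by omega)
  omega

lemma Critical.card_inter_mid_of_one (h : Critical A B C) {g : ZMod p}
    (hg : (inter A g).card = 1) :
    B.card ≤ A.card + (inter B g).card ∧ A.card + (inter B g).card ≤ B.card + 1 := by
  obtain ⟨h1, h2, h3, h4, h5, h6, h7, h8⟩ := h.extremal
  have h9 := h.left_le_mid
  have h10 := card_union_add_card_inter B g
  have h13 := card_le_card_union B g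
  have h11 := (h1.inter_union g).card_le (Finset.card_pos.1 (by omega))
    (Finset.card_pos.1 (by omega)) (Finset.card_pos.1 (by omega))
  refine ⟨by omega, ?_⟩
  by_cases hβ : 2 ≤ (inter B g).card
  · have h12 := h.card_inter_mid_le (g := g) (by omega)
    omega
  · omega

lemma Critical.cap_eq (h : Critical A B C) {e : ZMod p} (he : 3 ≤ (cap A B e).card) :
    cap A B e = A := by
  obtain ⟨h1, h2, h3, h4, h5, h6, h7, h8⟩ := h.extremal
  have h9 := h.left_le_mid
  have h10 := h.left_le_right
  refine Finset.eq_of_subset_of_card_le (Finset.filter_subset _ _) ?_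
  by_contra hlt
  have h11 := card_cap_add_card_cup A B e
  obtain ⟨d, hd, -, -, hC⟩ := h.minimal (cap A B e) (cup A B e) C (by omega)
    ⟨h1.cap_cup e, by omega, by omega, by omega, by omega, by omega, by omega, by omega⟩
  exact h.irregular_right d hd hC

lemma Critical.card_residual (h : Critical A B C) {u v : ZMod p} (hu : u ∈ A) (hv : v ∈ A)
    (huv : u ≠ v) (hC : (inter C (v - u)).card + 3 ≤ C.card) :
    (residual A B).card = (inter B (v - u)).card := by
  refine le_antisymm (card_residual_le_card_inter hu hv) (card_inter_le_card_residual (u := u) ?_)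
  obtain ⟨h1, h2, h3, h4, h5, h6, h7, h8⟩ := h.extremal
  intro x hx
  rw [mem_inter] at hx
  have hu' : u ∈ cap A B (u - x) := mem_cap.2 ⟨hu, by simpa using hx.1⟩
  have hv' : v ∈ cap A B (u - x) :=
    mem_cap.2 ⟨hv, by rw [show v - (u - x) = x + (v - u) by ring]; exact hx.2⟩
  have hr : 2 ≤ (cap A B (u - x)).card := by
    rw [← Finset.card_pair huv]
    apply Finset.card_le_card
    intro t ht
    rw [Finset.mem_insert, Finset.mem_singleton] at ht
    rcases ht with rfl | rfl <;> assumption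
  have hcup := card_cap_add_card_cup A B (u - x)
  have hr3 : 3 ≤ (cap A B (u - x)).card := by
    by_contra hlt
    have hle := card_cap_le A B (u - x)
    have hunion := card_union_add_card_inter C (v - u)
    have h9 := card_le_card_union C (v - u)
    have hin : (inter (cap A B (u - x)) (v - u)).Nonempty :=
      ⟨u, mem_inter.2 ⟨hu', by simpa using hv'⟩⟩
    have h10 := ((h1.cap_cup (u - x)).rotate.rotate.swap.inter_union (v - u)).card_le hin
      (union_nonempty (Finset.card_pos.1 (by omega))) (Finset.card_pos.1 (by omega))
    have h11 := hin.card_pos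
    omega
  have heq := h.cap_eq hr3
  rw [mem_residual]
  intro t ht
  rw [← heq, mem_cap] at ht
  rw [show t + (x - u) = t - (u - x) by ring]
  exact ht.2

end Critical

lemma Irregular.add_card_residual_le {A B : Finset (ZMod p)} (hA : Irregular A)
    (hA2 : 2 ≤ A.card) (hB : B.card + 2 ≤ p) (hy : 2 ≤ (residual A B).card) :
    A.card + (residual A B).card ≤ B.card := by
  have h1 := card_image_neg_compl B
  have h2 := (trio_residual A B).rotate.card_le_of_irregular hy (by omega) hA2 hA
  omega

lemma Irregular.add_card_residual_ne {A B : Finset (ZMod p)} (hA : Irregular A)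
    (ih : ∀ A' B' C' : Finset (ZMod p), A'.card < A.card ∨ (A'.card = A.card ∧ B'.card < B.card) →
      Extremal A' B' C' → AllAlmostAP A' B' C')
    (hA3 : 3 ≤ A.card) (hB : 2 * B.card ≤ p)
    (hy : 3 ≤ (residual A B).card) (hAy : 7 ≤ A.card + (residual A B).card) :
    A.card + (residual A B).card ≠ B.card := by
  intro he
  have h1 := card_image_neg_compl B
  have hext : Extremal A (residual A B) (Bᶜ.image (-·)) :=
    ⟨trio_residual A B, hA3, hy, by omega, hAy, by omega, by omega, by omega⟩
  rcases lt_or_ge (residual A B).card A.card with hlt | hge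
  · obtain ⟨d, hd, -, hd', -⟩ := ih _ _ _ (Or.inl hlt) hext.swap
    exact hA d hd hd'
  · obtain ⟨d, hd, hd', -, -⟩ := ih _ _ _ (Or.inr ⟨rfl, by omega⟩) hext
    exact hA d hd hd'

/-- The image in `ℤ/pℤ` of a set of points of the plane lattice. -/
def latticeImage (g h x : ZMod p) (L : Finset (ℤ × ℤ)) : Finset (ZMod p) :=
  L.image fun q => x + ((q.1 : ZMod p) * g + (q.2 : ZMod p) * h)

/-- The only relations with small coefficients between `g` and `h` are trivial. -/
def HexFree (g h : ZMod p) : Prop :=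
  ∀ i j : ℤ, |i| ≤ 3 → |j| ≤ 3 → |i + j| ≤ 3 → (i : ZMod p) * g + (j : ZMod p) * h = 0 →
    i = 0 ∧ j = 0

lemma mem_latticeImage {g h x y : ZMod p} {L : Finset (ℤ × ℤ)} :
    y ∈ latticeImage g h x L ↔
      ∃ q ∈ L, y = x + ((q.1 : ZMod p) * g + (q.2 : ZMod p) * h) := by
  simp only [latticeImage, Finset.mem_image, eq_comm]

lemma latticeImage_add (g h x y : ZMod p) (L M : Finset (ℤ × ℤ)) :
    latticeImage g h x L + latticeImage g h y M = latticeImage g h (x + y) (L + M) := by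
  ext z
  simp only [Finset.mem_add, mem_latticeImage]
  constructor
  · rintro ⟨_, ⟨q, hq, rfl⟩, _, ⟨r, hr, rfl⟩, rfl⟩
    exact ⟨q + r, ⟨q, hq, r, hr, rfl⟩, by push_cast [Prod.fst_add, Prod.snd_add]; ring⟩
  · rintro ⟨_, ⟨q, hq, r, hr, rfl⟩, rfl⟩
    exact ⟨_, ⟨q, hq, rfl⟩, _, ⟨r, hr, rfl⟩, by push_cast [Prod.fst_add, Prod.snd_add]; ring⟩

lemma latticeImage_neg (g h x : ZMod p) (L : Finset (ℤ × ℤ)) :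
    -latticeImage g h x L = latticeImage g h (-x) (-L) := by
  ext z
  simp only [Finset.mem_neg, mem_latticeImage]
  constructor
  · rintro ⟨_, ⟨q, hq, rfl⟩, rfl⟩
    exact ⟨-q, ⟨q, hq, rfl⟩, by push_cast [Prod.fst_neg, Prod.snd_neg]; ring⟩
  · rintro ⟨_, ⟨q, hq, rfl⟩, rfl⟩
    exact ⟨_, ⟨q, hq, rfl⟩, by push_cast [Prod.fst_neg, Prod.snd_neg]; ring⟩

lemma HexFree.eq {g h : ZMod p} (hgh : HexFree g h) {q r : ℤ × ℤ} {x : ZMod p}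
    (hqr : |q.1 - r.1| ≤ 3 ∧ |q.2 - r.2| ≤ 3 ∧ |q.1 - r.1 + (q.2 - r.2)| ≤ 3)
    (he : x + ((q.1 : ZMod p) * g + (q.2 : ZMod p) * h)
      = x + ((r.1 : ZMod p) * g + (r.2 : ZMod p) * h)) : q = r := by
  have := hgh (q.1 - r.1) (q.2 - r.2) hqr.1 hqr.2.1 hqr.2.2 (by
    push_cast; linear_combination he)
  ext <;> omega

lemma HexFree.card_latticeImage {g h : ZMod p} (hgh : HexFree g h) (x : ZMod p)
    {L : Finset (ℤ × ℤ)}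
    (hL : ∀ q ∈ L, ∀ r ∈ L, |q.1 - r.1| ≤ 3 ∧ |q.2 - r.2| ≤ 3 ∧ |q.1 - r.1 + (q.2 - r.2)| ≤ 3) :
    (latticeImage g h x L).card = L.card :=
  Finset.card_image_of_injOn fun q hq r hr he => hgh.eq (hL q hq r hr) he

/-- The vertices of the standard triangle. -/
def triangle : Finset (ℤ × ℤ) := {(0, 0), (1, 0), (0, 1)}

lemma latticeImage_triangle (x y z : ZMod p) :
    latticeImage (y - x) (z - x) x triangle = {x, y, z} := by
  simp [latticeImage, triangle]

lemma latticeImage_pair (g h x : ZMod p) :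
    latticeImage g h x {(0, 0), (1, 0)} = {x, x + g} := by
  simp [latticeImage]

lemma two_ne_zero_of_lt (hp : 3 < p) : (2 : ZMod p) ≠ 0 := by
  intro h
  have := (ZMod.natCast_eq_zero_iff 2 p).1 (by exact_mod_cast h)
  have := Nat.le_of_dvd (by norm_num) this
  omega

lemma three_ne_zero_of_lt (hp : 3 < p) : (3 : ZMod p) ≠ 0 := by
  intro h
  have := (ZMod.natCast_eq_zero_iff 3 p).1 (by exact_mod_cast h)
  have := Nat.le_of_dvd (by norm_num) this
  omega

lemma Irregular.not_triple {x y z d s : ZMod p} (hA : Irregular {x, y, z}) (hd : d ≠ 0)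
    (hxy : x ≠ y) (hxz : x ≠ z) (hyz : y ≠ z) (i j k : ℕ) (hi : i < 4) (hj : j < 4) (hk : k < 4)
    (hx : x = s + i * d) (hy : y = s + j * d) (hz : z = s + k * d) : False := by
  have hc : ({x, y, z} : Finset (ZMod p)).card = 3 := Finset.card_eq_three.2
    ⟨x, y, z, hxy, hxz, hyz, rfl⟩
  refine hA d hd ⟨s, ?_⟩
  rw [hc]
  intro t ht
  simp only [Finset.mem_insert, Finset.mem_singleton] at ht
  rcases ht with rfl | rfl | rfl
  · exact mem_ap.2 ⟨i, hi, hx⟩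
  · exact mem_ap.2 ⟨j, hj, hy⟩
  · exact mem_ap.2 ⟨k, hk, hz⟩

lemma Irregular.hexFree (hp : 3 < p) {x y z : ZMod p} (hA : Irregular {x, y, z}) (hxy : x ≠ y)
    (hxz : x ≠ z) (hyz : y ≠ z) : HexFree (y - x) (z - x) := by
  have h2 := two_ne_zero_of_lt hp
  have h3 := three_ne_zero_of_lt hp
  have hy : y - x ≠ 0 := sub_ne_zero.2 hxy.symm
  have hz : z - x ≠ 0 := sub_ne_zero.2 hxz.symm
  have hzy : z - y ≠ 0 := sub_ne_zero.2 hyz.symm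
  have key := fun d s hd i j k => hA.not_triple (d := d) (s := s) hd hxy hxz hyz i j k
  have e1 : (y - x) + (z - x) ≠ 0 := fun h => key (y - x) z hy 1 2 0 (by norm_num) (by norm_num)
    (by norm_num) (by push_cast; linear_combination -h) (by push_cast; linear_combination -h)
    (by push_cast; ring)
  have e2 : 2 * (y - x) - (z - x) ≠ 0 := fun h => key (y - x) x hy 0 1 2 (by norm_num)
    (by norm_num) (by norm_num) (by push_cast; ring) (by push_cast; ring)
    (by push_cast; linear_combination -h)
  have e3 : (y - x) - 2 * (z - x) ≠ 0 := fun h => key (z - x) x hz 0 2 1 (by norm_num)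
    (by norm_num) (by norm_num) (by push_cast; ring) (by push_cast; linear_combination h)
    (by push_cast; ring)
  have e4 : 2 * (y - x) + (z - x) ≠ 0 := fun h => key (y - x) z hy 2 3 0 (by norm_num)
    (by norm_num) (by norm_num) (by push_cast; linear_combination -h)
    (by push_cast; linear_combination -h) (by push_cast; ring)
  have e5 : (y - x) + 2 * (z - x) ≠ 0 := fun h => key (z - x) y hz 2 0 3 (by norm_num)
    (by norm_num) (by norm_num) (by push_cast; linear_combination -h) (by push_cast; ring)
    (by push_cast; linear_combination -h)
  have e6 : 3 * (y - x) - (z - x) ≠ 0 := fun h => key (y - x) x hy 0 1 3 (by norm_num)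
    (by norm_num) (by norm_num) (by push_cast; ring) (by push_cast; ring)
    (by push_cast; linear_combination -h)
  have e7 : (y - x) - 3 * (z - x) ≠ 0 := fun h => key (z - x) x hz 0 3 1 (by norm_num)
    (by norm_num) (by norm_num) (by push_cast; ring) (by push_cast; linear_combination h)
    (by push_cast; ring)
  have e8 : 3 * (y - x) - 2 * (z - x) ≠ 0 := fun h => key (z - y) x hzy 0 2 3 (by norm_num)
    (by norm_num) (by norm_num) (by push_cast; ring) (by push_cast; linear_combination h)
    (by push_cast; linear_combination h)
  have e9 : 2 * (y - x) - 3 * (z - x) ≠ 0 := fun h => key (y - z) x (by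
    rw [← neg_sub]; exact neg_ne_zero.2 hzy) 0 3 2 (by norm_num)
    (by norm_num) (by norm_num) (by push_cast; ring) (by push_cast; linear_combination -h)
    (by push_cast; linear_combination -h)
  have e10 : (y - x) - (z - x) ≠ 0 := by
    intro h; exact hyz (by linear_combination h)
  generalize y - x = g at *
  generalize z - x = h at *
  clear key
  have pos : ∀ i j : ℤ, |i| ≤ 3 → |j| ≤ 3 → |i + j| ≤ 3 → 0 < i ∨ i = 0 ∧ 0 < j →
      (i : ZMod p) * g + (j : ZMod p) * h ≠ 0 := by
    intro i j hi hj hij hne he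
    rw [abs_le] at hi hj hij
    obtain ⟨hi1, hi2⟩ := hi
    obtain ⟨hj1, hj2⟩ := hj
    have hi0 : 0 ≤ i := by omega
    clear hi1
    interval_cases i <;> interval_cases j <;> first | omega | push_cast at he
    all_goals first
      | exact hy (by linear_combination he)
      | exact hz (by linear_combination he)
      | exact e1 (by linear_combination he)
      | exact e2 (by linear_combination he)
      | exact e3 (by linear_combination he)
      | exact e4 (by linear_combination he)
      | exact e5 (by linear_combination he)
      | exact e6 (by linear_combination he)
      | exact e7 (by linear_combination he)
      | exact e8 (by linear_combination he)
      | exact e9 (by linear_combination he)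
      | exact e10 (by linear_combination he)
      | exact mul_ne_zero h2 hy (by linear_combination he)
      | exact mul_ne_zero h2 hz (by linear_combination he)
      | exact mul_ne_zero h3 hy (by linear_combination he)
      | exact mul_ne_zero h3 hz (by linear_combination he)
      | exact mul_ne_zero h2 e10 (by linear_combination he)
      | exact mul_ne_zero h3 e10 (by linear_combination he)
  intro i j hi hj hij he
  by_contra hne
  rcases lt_trichotomy i 0 with hi0 | rfl | hi0
  · refine pos (-i) (-j) (by rwa [abs_neg]) (by rwa [abs_neg])
      (by rwa [← neg_add, abs_neg]) (Or.inl (by omega)) (by push_cast; linear_combination -he)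
  · rcases lt_trichotomy j 0 with hj0 | rfl | hj0
    · refine pos 0 (-j) (by simp) (by rwa [abs_neg]) (by simpa using hj)
        (Or.inr ⟨rfl, by omega⟩) (by push_cast at he ⊢; linear_combination -he)
    · exact hne ⟨rfl, rfl⟩
    · exact pos 0 j hi hj hij (Or.inr ⟨rfl, hj0⟩) he
  · exact pos i j hi hj hij (Or.inl hi0) he

lemma Irregular.card_inter_le_one {A : Finset (ZMod p)} (hp : 3 < p) (hA : Irregular A)
    (hA3 : A.card = 3) {k : ZMod p} (hk : k ≠ 0) : (inter A k).card ≤ 1 := by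
  by_contra hlt
  obtain ⟨s, hs⟩ := exists_subset_ap hk (Finset.card_pos.1 (by omega)) (by omega)
    (show A.card ≤ (inter A k).card + 1 by omega)
  exact hA k hk ⟨s, hs.trans (ap_mono (by omega))⟩

lemma card_add_pair (A : Finset (ZMod p)) (t k : ZMod p) :
    (A + {t, t + k}).card = (union A k).card := by
  rw [← Finset.card_image_of_injective (union A k) (add_left_injective t)]
  congr 1
  ext x
  simp only [Finset.mem_add, Finset.mem_image, mem_union, Finset.mem_insert,
    Finset.mem_singleton]
  constructor
  · rintro ⟨a, ha, _, rfl | rfl, rfl⟩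
    · exact ⟨a, Or.inl ha, rfl⟩
    · exact ⟨a + k, Or.inr (by simpa using ha), by ring⟩
  · rintro ⟨a, ha | ha, rfl⟩
    · exact ⟨a, ha, t, Or.inl rfl, rfl⟩
    · exact ⟨a - k, ha, t + k, Or.inr rfl, by ring⟩

lemma exists_eq_triple {p : ℕ} {A : Finset (ZMod p)} (hA : A.card = 3) {x y : ZMod p} (hx : x ∈ A)
    (hy : y ∈ A) (hxy : x ≠ y) : ∃ z, A = {x, y, z} ∧ x ≠ z ∧ y ≠ z := by
  have h1 : ((A.erase x).erase y).card = 1 := by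
    rw [Finset.card_erase_of_mem (Finset.mem_erase.2 ⟨hxy.symm, hy⟩), Finset.card_erase_of_mem hx]
    omega
  obtain ⟨z, hz⟩ := Finset.card_eq_one.1 h1
  have hz' : z ∈ (A.erase x).erase y := by rw [hz]; simp
  simp only [Finset.mem_erase] at hz'
  refine ⟨z, ?_, fun h => hz'.2.1 h.symm, fun h => hz'.1 h.symm⟩
  rw [← hz, Finset.insert_erase (Finset.mem_erase.2 ⟨hxy.symm, hy⟩), Finset.insert_erase hx]

lemma exists_eq_pair_of_card_add_le {A Y : Finset (ZMod p)} (hA : A.card = 3) (hY : Y.card = 2)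
    (hAY : (A + Y).card ≤ 5) :
    ∃ x y z t, A = {x, y, z} ∧ x ≠ y ∧ x ≠ z ∧ y ≠ z ∧ Y = {t, t + (y - x)} := by
  obtain ⟨t, t', htt, rfl⟩ := Finset.card_eq_two.1 hY
  rw [show t' = t + (t' - t) by ring, card_add_pair] at hAY
  have h1 := card_union_add_card_inter A (t' - t)
  obtain ⟨x, hx⟩ := Finset.card_pos.1 (show 0 < (inter A (t' - t)).card by omega)
  rw [mem_inter] at hx
  have hne : x ≠ x + (t' - t) := by
    intro h
    exact htt (by linear_combination h)
  obtain ⟨z, hz, hxz, hyz⟩ := exists_eq_triple hA hx.1 hx.2 hne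
  exact ⟨x, _, z, t, hz, hne, hxz, hyz, by congr 2; ring⟩

lemma Irregular.exists_eq_translate_of_card_add_le {A Y : Finset (ZMod p)} (hp : 3 < p)
    (hA : Irregular A) (hA3 : A.card = 3) (hY : Y.card = 3) (hAY : (A + Y).card ≤ 6) :
    ∃ x y z t, A = {x, y, z} ∧ x ≠ y ∧ x ≠ z ∧ y ≠ z ∧
      Y = latticeImage (y - x) (z - x) t triangle := by
  obtain ⟨t, u, v, htu, htv, huv, rfl⟩ := Finset.card_eq_three.1 hY
  have h0 := card_triple_add A t u v
  have h1 := hA.card_inter_le_one hp hA3 (sub_ne_zero.2 htu.symm)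
  have h2 := hA.card_inter_le_one hp hA3 (sub_ne_zero.2 htv.symm)
  have h3 := hA.card_inter_le_one hp hA3 (sub_ne_zero.2 huv.symm)
  rw [add_comm] at hAY
  obtain ⟨x, hx⟩ := Finset.card_pos.1 (show 0 < (inter A (u - t)).card by omega)
  obtain ⟨a, ha⟩ := Finset.card_pos.1 (show 0 < (inter A (v - t)).card by omega)
  obtain ⟨b, hb⟩ := Finset.card_pos.1 (show 0 < (inter A (v - u)).card by omega)
  rw [mem_inter] at hx ha hb
  have hne : x ≠ x + (u - t) := by
    intro h
    exact htu (by linear_combination h)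
  obtain ⟨z, hz, hxz, hyz⟩ := exists_eq_triple hA3 hx.1 hx.2 hne
  obtain ⟨y, hy⟩ : ∃ y, y = x + (u - t) := ⟨_, rfl⟩
  rw [← hy] at hz hne hyz hx
  have hAeq : A = latticeImage (y - x) (z - x) x triangle := by rw [hz, latticeImage_triangle]
  have hu : u = t + (y - x) := by rw [hy]; ring
  refine ⟨x, y, z, t, hz, hne, hxz, hyz, ?_⟩
  rw [hz] at hA
  have hex := hA.hexFree hp hne hxz hyz
  generalize y - x = g at *
  generalize z - x = h at *
  subst hu
  rw [hAeq, mem_latticeImage, mem_latticeImage] at ha hb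
  obtain ⟨⟨q, hq, rfl⟩, q', hq', haq⟩ := ha
  obtain ⟨⟨r, hr, rfl⟩, r', hr', hbr⟩ := hb
  have hv : v = t + (((q' - q).1 : ZMod p) * g + ((q' - q).2 : ZMod p) * h) := by
    push_cast [Prod.fst_sub, Prod.snd_sub]
    linear_combination haq
  have hformal : q' - q = r' - r + (1, 0) := by
    apply hex.eq (x := t)
    · have hbound : ∀ q ∈ triangle, ∀ q' ∈ triangle, ∀ r ∈ triangle, ∀ r' ∈ triangle,
          |(q' - q).1 - (r' - r + (1, 0)).1| ≤ 3 ∧ |(q' - q).2 - (r' - r + (1, 0)).2| ≤ 3 ∧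
            |(q' - q).1 - (r' - r + (1, 0)).1 + ((q' - q).2 - (r' - r + (1, 0)).2)| ≤ 3 := by
        decide
      exact hbound q hq q' hq' r hr r' hr'
    · push_cast [Prod.fst_sub, Prod.snd_sub, Prod.fst_add, Prod.snd_add]
      linear_combination hbr - haq
  have hm : ∀ q ∈ triangle, ∀ q' ∈ triangle, ∀ r ∈ triangle, ∀ r' ∈ triangle,
      q' - q = r' - r + (1, 0) → q' - q = (0, 0) ∨ q' - q = (1, 0) ∨ q' - q = (0, 1) ∨
        q' - q = (1, -1) := by decide
  rcases hm q hq q' hq' r hr r' hr' hformal with he | he | he | he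
  · rw [he] at hv; exact absurd hv (by simpa using htv.symm)
  · rw [he] at hv; exact absurd hv (by simpa using huv.symm)
  · rw [he] at hv
    rw [hv]
    simp [latticeImage, triangle]
  · rw [he] at hv
    exfalso
    have hY : ({t, t + g, v} : Finset (ZMod p)) = latticeImage g h t {(0, 0), (1, 0), (1, -1)} := by
      rw [hv]; simp [latticeImage]
    rw [hY, hAeq, latticeImage_add, hex.card_latticeImage] at hAY
    · revert hAY; decide
    · decide

/-- A three-element irregular set `A` has no small sum with a small set `B` containing many
translates of `A`. -/
lemma Irregular.lt_card_add {A B S : Finset (ZMod p)} (hp : 3 < p) (hA : Irregular A)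
    (hA3 : A.card = 3) (hB : (residual A B).card + 3 = B.card) (hB4 : 4 ≤ B.card)
    (hB6 : B.card ≤ 6) (hS : S = A ∨ S = -A) : B.card + 3 < (S + B).card := by
  have hsub : A + residual A B ⊆ B := by
    intro t ht
    obtain ⟨a, ha, y, hy, rfl⟩ := Finset.mem_add.1 ht
    exact mem_residual.1 hy a ha
  have hAY := Finset.card_le_card hsub
  have hSAY : (S + (A + residual A B)).card ≤ (S + B).card :=
    Finset.card_le_card (Finset.add_subset_add_left hsub)
  obtain hb | hb | hb : B.card = 4 ∨ B.card = 5 ∨ B.card = 6 := by omega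
  · obtain ⟨t, ht⟩ := Finset.card_eq_one.1 (show (residual A B).card = 1 by omega)
    obtain ⟨x, y, z, hxy, hxz, hyz, hA'⟩ := Finset.card_eq_three.1 hA3
    rw [hA'] at hA
    have hex := hA.hexFree hp hxy hxz hyz
    rw [← latticeImage_triangle] at hA'
    have hY : residual A B = latticeImage (y - x) (z - x) t {(0, 0)} := by
      rw [ht]; simp [latticeImage]
    rw [hY] at hsub hSAY
    generalize y - x = g at *
    generalize z - x = h at *
    have hAY3 : (A + latticeImage g h t {(0, 0)}).card = 3 := by
      rw [hA', latticeImage_add, hex.card_latticeImage _ (by decide)]; rfl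
    obtain ⟨s, hs, hs'⟩ := Finset.exists_mem_notMem_of_card_lt_card
      (show (A + latticeImage g h t {(0, 0)}).card < B.card by omega)
    have hI : (S.image (· + s)).card = 3 := by
      rw [Finset.card_image_of_injective _ (add_left_injective s)]
      rcases hS with rfl | rfl
      · exact hA3
      · rw [Finset.card_neg, hA3]
    have hU := Finset.card_le_card (show S.image (· + s) ∪ (S + (A + latticeImage g h t {(0, 0)}))
      ⊆ S + B from Finset.union_subset (by
        intro r hr
        obtain ⟨a, ha, rfl⟩ := Finset.mem_image.1 hr
        exact Finset.add_mem_add ha hs) (Finset.add_subset_add_left hsub))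
    have hIU := Finset.card_union_add_card_inter (S.image (· + s))
      (S + (A + latticeImage g h t {(0, 0)}))
    by_contra hlt
    rcases hS with rfl | rfl
    · have hW : (S + (S + latticeImage g h t {(0, 0)})).card = 6 := by
        rw [hA', latticeImage_add, latticeImage_add, hex.card_latticeImage _ (by decide)]; rfl
      obtain ⟨r₁, hr₁, r₂, hr₂, hne⟩ := Finset.one_lt_card.1 (show 1 < (S.image (· + s) ∩
        (S + (S + latticeImage g h t {(0, 0)}))).card by omega)
      rw [hA', latticeImage_add] at hs'
      rw [hA', latticeImage_add, latticeImage_add, Finset.mem_inter, Finset.mem_image,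
        mem_latticeImage] at hr₁ hr₂
      obtain ⟨⟨a₁, ha₁, rfl⟩, w₁, hw₁, e₁⟩ := hr₁
      obtain ⟨⟨a₂, ha₂, rfl⟩, w₂, hw₂, e₂⟩ := hr₂
      obtain ⟨q₁, hq₁, rfl⟩ := mem_latticeImage.1 ha₁
      obtain ⟨q₂, hq₂, rfl⟩ := mem_latticeImage.1 ha₂
      have hbound : ∀ q₁ ∈ triangle, ∀ q₂ ∈ triangle, ∀ w₁ ∈ triangle + (triangle + {(0, 0)}),
          ∀ w₂ ∈ triangle + (triangle + {(0, 0)}),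
          (|(w₁ + q₂).1 - (w₂ + q₁).1| ≤ 3 ∧ |(w₁ + q₂).2 - (w₂ + q₁).2| ≤ 3 ∧
            |(w₁ + q₂).1 - (w₂ + q₁).1 + ((w₁ + q₂).2 - (w₂ + q₁).2)| ≤ 3) ∧
          (w₁ + q₂ = w₂ + q₁ → q₁ ≠ q₂ → w₁ - q₁ ∈ triangle + {(0, 0)}) := by
        decide
      obtain ⟨hb1, hb2⟩ := hbound q₁ hq₁ q₂ hq₂ w₁ hw₁ w₂ hw₂
      have hformal : w₁ + q₂ = w₂ + q₁ := hex.eq (x := x) hb1 (by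
        push_cast [Prod.fst_add, Prod.snd_add]
        linear_combination e₂ - e₁)
      refine hs' (mem_latticeImage.2 ⟨_, hb2 hformal ?_, ?_⟩)
      · rintro rfl; exact hne rfl
      · push_cast [Prod.fst_sub, Prod.snd_sub]
        linear_combination e₁
    · have hW : (-A + (A + latticeImage g h t {(0, 0)})).card = 7 := by
        rw [hA', latticeImage_neg, latticeImage_add, latticeImage_add,
          hex.card_latticeImage _ (by decide)]
        rfl
      have hall : ∀ q ∈ triangle, ∃ w ∈ -triangle + (triangle + {(0, 0)}),
          s - x - ((q.1 : ZMod p) * g + (q.2 : ZMod p) * h)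
            = t + ((w.1 : ZMod p) * g + (w.2 : ZMod p) * h) := by
        intro q hq
        have heq := Finset.eq_of_subset_of_card_le (Finset.inter_subset_left
          (s₁ := (-A).image (· + s)) (s₂ := -A + (A + latticeImage g h t {(0, 0)}))) (by omega)
        have hm : -(x + ((q.1 : ZMod p) * g + (q.2 : ZMod p) * h)) + s ∈ (-A).image (· + s) :=
          Finset.mem_image_of_mem (· + s) (Finset.neg_mem_neg (by
            rw [hA']; exact mem_latticeImage.2 ⟨q, hq, rfl⟩))
        rw [← heq, Finset.mem_inter, hA', latticeImage_neg, latticeImage_add, latticeImage_add,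
          mem_latticeImage] at hm
        obtain ⟨-, w, hw, e⟩ := hm
        exact ⟨w, hw, by linear_combination e⟩
      obtain ⟨w₀, hw₀, e₀⟩ := hall (0, 0) (by decide)
      obtain ⟨w₁, hw₁, e₁⟩ := hall (1, 0) (by decide)
      obtain ⟨w₂, hw₂, e₂⟩ := hall (0, 1) (by decide)
      have hbound : ∀ q ∈ triangle, ∀ w₀ ∈ -triangle + (triangle + {(0, 0)}),
          ∀ w₁ ∈ -triangle + (triangle + {(0, 0)}),
          |(w₀ - q).1 - w₁.1| ≤ 3 ∧ |(w₀ - q).2 - w₁.2| ≤ 3 ∧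
            |(w₀ - q).1 - w₁.1 + ((w₀ - q).2 - w₁.2)| ≤ 3 := by
        decide
      have f₁ : w₀ - (1, 0) = w₁ := hex.eq (x := t) (hbound _ (by decide) _ hw₀ _ hw₁) (by
        push_cast [Prod.fst_sub, Prod.snd_sub] at e₀ e₁ ⊢
        linear_combination e₁ - e₀)
      have f₂ : w₀ - (0, 1) = w₂ := hex.eq (x := t) (hbound _ (by decide) _ hw₀ _ hw₂) (by
        push_cast [Prod.fst_sub, Prod.snd_sub] at e₀ e₂ ⊢
        linear_combination e₂ - e₀)
      have hw : ∀ w ∈ -triangle + (triangle + {(0, 0)}),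
          w - (1, 0) ∈ -triangle + (triangle + {(0, 0)}) →
          w - (0, 1) ∈ -triangle + (triangle + {(0, 0)}) → w ∈ triangle + {(0, 0)} := by
        decide
      rw [hA', latticeImage_add] at hs'
      refine hs' (mem_latticeImage.2 ⟨w₀, hw _ hw₀ (by rwa [f₁]) (by rwa [f₂]), ?_⟩)
      push_cast at e₀
      linear_combination e₀
  · obtain ⟨x, y, z, t, hA', hxy, hxz, hyz, hY⟩ :=
      exists_eq_pair_of_card_add_le hA3 (show (residual A B).card = 2 by omega) (by omega)
    rw [hA'] at hA
    have hex := hA.hexFree hp hxy hxz hyz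
    rw [← latticeImage_triangle] at hA'
    rw [← latticeImage_pair (y - x) (z - x) t] at hY
    rcases hS with rfl | rfl
    · rw [hY, hA', latticeImage_add, latticeImage_add, hex.card_latticeImage _ (by decide)]
        at hSAY
      rw [hA', hb]
      exact lt_of_lt_of_le (by decide) hSAY
    · rw [hY, hA', latticeImage_neg, latticeImage_add, latticeImage_add,
        hex.card_latticeImage _ (by decide)] at hSAY
      rw [hA', latticeImage_neg, hb]
      exact lt_of_lt_of_le (by decide) hSAY
  · obtain ⟨x, y, z, t, hA', hxy, hxz, hyz, hY⟩ :=
      hA.exists_eq_translate_of_card_add_le hp hA3 (show (residual A B).card = 3 by omega)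
        (by omega)
    rw [hA'] at hA
    have hex := hA.hexFree hp hxy hxz hyz
    rw [← latticeImage_triangle] at hA'
    rcases hS with rfl | rfl
    · rw [hY, hA', latticeImage_add, latticeImage_add, hex.card_latticeImage _ (by decide)]
        at hSAY
      rw [hA', hb]
      exact lt_of_lt_of_le (by decide) hSAY
    · rw [hY, hA', latticeImage_neg, latticeImage_add, latticeImage_add,
        hex.card_latticeImage _ (by decide)] at hSAY
      rw [hA', latticeImage_neg, hb]
      exact lt_of_lt_of_le (by decide) hSAY

lemma card_add_self_le_of_residual {A B : Finset (ZMod p)} {y : ZMod p} (hy : y ∈ residual A B) :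
    (A + A).card ≤ (A + B).card := by
  rw [← Finset.card_image_of_injective (A + A) (add_left_injective y)]
  apply Finset.card_le_card
  intro x hx
  obtain ⟨z, hz, rfl⟩ := Finset.mem_image.1 hx
  obtain ⟨a, ha, b, hb, rfl⟩ := Finset.mem_add.1 hz
  rw [add_assoc]
  exact Finset.add_mem_add ha (mem_residual.1 hy b hb)

lemma trio_neg_compl (A B : Finset (ZMod p)) : Trio A B ((A + B)ᶜ.image (-·)) := by
  intro a ha b hb c hc h0
  obtain ⟨c', hc', rfl⟩ := Finset.mem_image.1 hc
  rw [Finset.mem_compl] at hc'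
  exact hc' (by
    rw [show c' = a + b by linear_combination -h0]
    exact Finset.add_mem_add ha hb)

lemma inter_nonempty {A : Finset (ZMod p)} {u v : ZMod p} (hu : u ∈ A) (hv : v ∈ A) :
    (inter A (v - u)).Nonempty := ⟨u, mem_inter.2 ⟨hu, by simpa using hv⟩⟩

/-- All triples that precede `(A, B, C)` in the induction satisfy the theorem. -/
def PrecedingHold (A B : Finset (ZMod p)) : Prop :=
  ∀ A' B' C' : Finset (ZMod p), A'.card < A.card ∨ (A'.card = A.card ∧ B'.card < B.card) →
    Extremal A' B' C' → AllAlmostAP A' B' C'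

section Critical

variable {A B C : Finset (ZMod p)}

lemma Critical.card_add_residual_cases (h : Critical A B C) (ha : 4 ≤ A.card) {u v : ZMod p}
    (hu : u ∈ A) (hv : v ∈ A) (huv : u ≠ v) (h1 : (inter A (v - u)).card = 1) :
    (residual A B).card = (inter B (v - u)).card ∧
      (A.card + (residual A B).card = B.card ∨
        A.card = B.card ∧ (residual A B).card = 1) := by
  obtain ⟨k1, k2, k3, k4, k5, k6, k7, k8⟩ := h.extremal
  have h2 := h.card_inter_mid_of_one h1
  have h3 := h.symm.card_inter_mid_of_one h1
  have h4 := h.card_residual hu hv huv (by omega)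
  have h5 := h.left_le_mid
  refine ⟨h4, ?_⟩
  by_cases hy : 2 ≤ (residual A B).card
  · have := h.irregular_left.add_card_residual_le (by omega) (by omega) hy
    omega
  · omega

lemma Critical.false_of_three_differences (h : Critical A B C) (hbc : B.card ≤ C.card)
    (ih : PrecedingHold A B) (ha : 4 ≤ A.card)
    {u v w : ZMod p} (hu : u ∈ A) (hv : v ∈ A) (hw : w ∈ A) (huv : u ≠ v) (huw : u ≠ w)
    (hvw : v ≠ w) (h1 : (inter A (v - u)).card = 1) (h2 : (inter A (w - u)).card = 1)
    (h3 : (inter A (w - v)).card = 1) : False := by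
  obtain ⟨k1, k2, k3, k4, k5, k6, k7, k8⟩ := h.extremal
  obtain ⟨y1, hcase⟩ := h.card_add_residual_cases ha hu hv huv h1
  obtain ⟨y2, -⟩ := h.card_add_residual_cases ha hu hw huw h2
  obtain ⟨y3, -⟩ := h.card_add_residual_cases ha hv hw hvw h3
  have hcard := k1.card_add_le
  rcases hcase with hcase | ⟨hab, hy⟩
  · have := three_mul_card_le B hu hv hw
    exact h.irregular_left.add_card_residual_ne ih (by omega) (by omega) (by omega) (by omega)
      hcase
  · obtain ⟨t, ht⟩ := Finset.card_pos.1 (show 0 < (residual A B).card by omega)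
    have := card_add_self_le_of_residual ht
    have := three_mul_card_le A hu hv hw
    omega

lemma Critical.card_lt_five (h : Critical A B C) (hbc : B.card ≤ C.card)
    (ih : PrecedingHold A B) : A.card < 5 := by
  by_contra hlt
  obtain ⟨k1, k2, k3, k4, k5, k6, k7, k8⟩ := h.extremal
  have key : ∀ u ∈ A, ∀ v ∈ A, u ≠ v → (inter A (v - u)).card = 1 := by
    intro u hu v hv huv
    have h1 := h.card_inter_le_two (sub_ne_zero.2 huv.symm)
    have h2 := (inter_nonempty hu hv).card_pos
    by_contra hne
    have h3 := h.card_inter_mid_of_two (g := v - u) (by omega)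
    have h4 := h.symm.card_inter_mid_of_two (g := v - u) (by omega)
    have h5 := h.card_residual hu hv huv (by omega)
    have h6 := h.left_le_mid
    have := h.irregular_left.add_card_residual_le (B := B) (by omega) (by omega) (by omega)
    omega
  obtain ⟨u, hu, v, hv, w, hw, huv, huw, hvw⟩ := Finset.two_lt_card.1 (show 2 < A.card by omega)
  exact h.false_of_three_differences hbc ih (by omega) hu hv hw huv huw hvw (key u hu v hv huv)
    (key u hu w hw huw) (key v hv w hw hvw)

lemma Critical.card_ne_three (h : Critical A B C) (hbc : B.card ≤ C.card)
    (ih : PrecedingHold A B) : A.card ≠ 3 := by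
  intro ha
  obtain ⟨k1, k2, k3, k4, k5, k6, k7, k8⟩ := h.extremal
  have hcard := k1.card_add_le
  have hA := h.irregular_left
  have hd : ∀ u ∈ A, ∀ v ∈ A, u ≠ v → (inter A (v - u)).card = 1 := by
    intro u hu v hv huv
    have h1 := hA.card_inter_le_one (by omega) ha (sub_ne_zero.2 huv.symm)
    have h2 := (inter_nonempty hu hv).card_pos
    omega
  have small : ∀ X : Finset (ZMod p), Irregular X → X.card = 3 → (A = X ∨ A = -X) →
      (residual X B).card + 3 = B.card → False := by
    intro X hX hX3 hAX hres
    have ihX : ∀ A' B' C' : Finset (ZMod p),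
        A'.card < X.card ∨ (A'.card = X.card ∧ B'.card < B.card) →
        Extremal A' B' C' → AllAlmostAP A' B' C' := by
      rw [hX3, ← ha]; exact ih
    have h6 : B.card ≤ 6 := by
      by_contra hlt
      exact hX.add_card_residual_ne ihX (by omega) (by omega) (by omega) (by omega) (by omega)
    have := hX.lt_card_add (by omega) hX3 hres (by omega) h6 hAX
    omega
  by_cases hI : ∃ u ∈ A, ∃ v ∈ A, u ≠ v ∧ (inter C (v - u)).card + 3 = C.card
  · obtain ⟨u, hu, v, hv, huv, hC⟩ := hI
    have h1 := h.card_residual hu hv huv (by omega)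
    have h2 := h.card_inter_mid_of_one (hd u hu v hv huv)
    refine small A hA ha (Or.inl rfl) ?_
    by_contra hne
    have := hA.add_card_residual_le (B := B) (by omega) (by omega) (by omega)
    omega
  · push Not at hI
    have hβ : ∀ u ∈ A, ∀ v ∈ A, u ≠ v → (inter B (v - u)).card + 2 = B.card := by
      intro u hu v hv huv
      have h1 := h.card_inter_mid_of_one (hd u hu v hv huv)
      have h2 := h.symm.card_inter_mid_of_one (hd u hu v hv huv)
      have h3 := hI u hu v hv huv
      by_contra hne
      have h4 := h.symm.card_residual hu hv huv (by omega)
      have := hA.add_card_residual_le (B := C) (by omega) (by omega) (by omega)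
      omega
    obtain ⟨u, v, w, huv, huw, hvw, hAeq⟩ := Finset.card_eq_three.1 ha
    have hu : u ∈ A := by rw [hAeq]; simp
    have hv : v ∈ A := by rw [hAeq]; simp
    have hw : w ∈ A := by rw [hAeq]; simp
    have h1 := hβ u hu v hv huv
    have h2 := hβ u hu w hw huw
    have h3 := hβ v hv w hw hvw
    have h4 := card_triple_add B u v w
    have hneg : ({-u, -v, -w} : Finset (ZMod p)) = -A := by
      rw [hAeq]; simp [Finset.neg_insert]
    rw [hneg, ← hAeq] at h4
    refine small (-A) hA.neg (by rw [Finset.card_neg, ha]) (Or.inr (neg_neg A).symm) ?_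
    have h5 := card_image_neg_compl (A + B)
    have h6 := (trio_neg_compl A B).rotate.card_le_of_irregular (by omega) (by omega) (by omega) hA
    omega

end Critical

lemma Irregular.not_quadruple {X : Finset (ZMod p)} (hX : Irregular X) (h4 : X.card = 4)
    {s d : ZMod p} (hd : d ≠ 0) (h : ∀ x ∈ X, ∃ j : ℕ, j ≤ 4 ∧ x = s + (j : ZMod p) * d) :
    False := by
  refine hX d hd ⟨s, fun x hx => ?_⟩
  obtain ⟨j, hj, hxj⟩ := h x hx
  exact mem_ap.2 ⟨j, by omega, hxj⟩

lemma card_inter_eq_one {X : Finset (ZMod p)} {g x : ZMod p} (hx : x ∈ X) (hxg : x + g ∈ X)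
    (h : ∀ y ∈ X, y + g ∈ X → y = x) : (inter X g).card = 1 := by
  rw [Finset.card_eq_one]
  refine ⟨x, Finset.ext fun y => ?_⟩
  rw [mem_inter, Finset.mem_singleton]
  constructor
  · rintro ⟨h1, h2⟩; exact h y h1 h2
  · rintro rfl; exact ⟨hx, hxg⟩

lemma mem_iff_of_card_eq_four {p : ℕ} {X : Finset (ZMod p)} (hX : X.card = 4) {x y z w : ZMod p}
    (hx : x ∈ X) (hy : y ∈ X) (hz : z ∈ X) (hw : w ∈ X) (hxy : x ≠ y) (hxz : x ≠ z) (hxw : x ≠ w)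
    (hyz : y ≠ z) (hyw : y ≠ w) (hzw : z ≠ w) (t : ZMod p) :
    t ∈ X ↔ t = x ∨ t = y ∨ t = z ∨ t = w := by
  have hsub : ({x, y, z, w} : Finset (ZMod p)) ⊆ X := by
    intro t ht
    simp only [Finset.mem_insert, Finset.mem_singleton] at ht
    rcases ht with rfl | rfl | rfl | rfl <;> assumption
  rw [← Finset.eq_of_subset_of_card_le hsub (by
    simp [hX, hxy, hxz, hxw, hyz, hyw, hzw])]
  simp

lemma sub_mem_residual {A B : Finset (ZMod p)} {u v s : ZMod p} (hu : u ∈ A) (hv : v ∈ A)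
    (h : (inter B (v - u)).card ≤ (residual A B).card) (hs : s ∈ B) (hs' : s + (v - u) ∈ B) :
    s - u ∈ residual A B := by
  have hsub : (residual A B).image (u + ·) ⊆ inter B (v - u) := by
    intro z hz
    obtain ⟨y, hy, rfl⟩ := Finset.mem_image.1 hz
    rw [mem_residual] at hy
    exact mem_inter.2 ⟨hy u hu, by rw [show u + y + (v - u) = v + y by ring]; exact hy v hv⟩
  have heq := Finset.eq_of_subset_of_card_le hsub
    (by rwa [Finset.card_image_of_injective _ (add_right_injective u)])
  have hmem : s ∈ inter B (v - u) := mem_inter.2 ⟨hs, hs'⟩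
  rw [← heq] at hmem
  obtain ⟨y, hy, rfl⟩ := Finset.mem_image.1 hmem
  simpa using hy

lemma sub_mem_or_sub_mem {A B : Finset (ZMod p)} {u v z : ZMod p} (hu : u ∈ A) (hv : v ∈ A)
    (h : (A + B).card + (inter B (v - u)).card ≤ 2 * B.card) (hz : z ∈ A + B) :
    z - u ∈ B ∨ z - v ∈ B := by
  have hsub : (union B (v - u)).image (u + ·) ⊆ A + B := by
    intro z hz
    obtain ⟨y, hy, rfl⟩ := Finset.mem_image.1 hz
    rcases mem_union.1 hy with hy | hy
    · exact Finset.add_mem_add hu hy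
    · rw [show u + y = v + (y - (v - u)) by ring]
      exact Finset.add_mem_add hv hy
  have hcard := card_union_add_card_inter B (v - u)
  have heq := Finset.eq_of_subset_of_card_le hsub
    (by rw [Finset.card_image_of_injective _ (add_right_injective u)]; omega)
  rw [← heq] at hz
  obtain ⟨y, hy, rfl⟩ := Finset.mem_image.1 hz
  rcases mem_union.1 hy with hy | hy
  · left; simpa using hy
  · right; rwa [show u + y - v = y - (v - u) by ring]

section Critical

variable {A B C : Finset (ZMod p)}

lemma Critical.false_of_chain (h : Critical A B C) (hbc : B.card ≤ C.card)
    (ih : PrecedingHold A B) (ha : A.card = 4) {x g e : ZMod p} (hg : g ≠ 0) (he : e ≠ 0)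
    (heg : e ≠ g) (he2 : e ≠ 2 * g)
    (hA : ∀ y, y ∈ A ↔ y = x ∨ y = x + g ∨ y = x + 2 * g ∨ y = x + e) : False := by
  obtain ⟨k1, k2, k3, k4, k5, k6, k7, k8⟩ := h.extremal
  have two := two_ne_zero_of_lt (p := p) (by omega)
  have three := three_ne_zero_of_lt (p := p) (by omega)
  have key : ∀ (s d : ZMod p) (i j k l : ℕ), d ≠ 0 → i ≤ 4 → j ≤ 4 → k ≤ 4 → l ≤ 4 →
      x = s + i * d → x + g = s + j * d → x + 2 * g = s + k * d → x + e = s + l * d → False := by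
    intro s d i j k l hd hi hj hk hl h1 h2 h3 h4
    refine h.irregular_left.not_quadruple ha hd (s := s) fun y hy => ?_
    rcases (hA y).1 hy with rfl | rfl | rfl | rfl
    exacts [⟨i, hi, h1⟩, ⟨j, hj, h2⟩, ⟨k, hk, h3⟩, ⟨l, hl, h4⟩]
  have e1 : e ≠ -g := fun h0 => key (x - g) g 1 2 3 0 hg (by norm_num) (by norm_num) (by norm_num)
    (by norm_num) (by push_cast; ring) (by push_cast; ring) (by push_cast; ring)
    (by push_cast; linear_combination h0)
  have e2 : e ≠ 3 * g := fun h0 => key x g 0 1 2 3 hg (by norm_num) (by norm_num) (by norm_num)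
    (by norm_num) (by push_cast; ring) (by push_cast; ring) (by push_cast; ring)
    (by push_cast; linear_combination h0)
  have e3 : e ≠ -2 * g := fun h0 => key (x - 2 * g) g 2 3 4 0 hg (by norm_num) (by norm_num)
    (by norm_num) (by norm_num) (by push_cast; ring) (by push_cast; ring) (by push_cast; ring)
    (by push_cast; linear_combination h0)
  have e4 : e ≠ 4 * g := fun h0 => key x g 0 1 2 4 hg (by norm_num) (by norm_num) (by norm_num)
    (by norm_num) (by push_cast; ring) (by push_cast; ring) (by push_cast; ring)
    (by push_cast; linear_combination h0)
  have e5 : 2 * e ≠ g := fun h0 => key x e 0 2 4 1 he (by norm_num) (by norm_num) (by norm_num)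
    (by norm_num) (by push_cast; ring) (by push_cast; linear_combination -h0)
    (by push_cast; linear_combination -2 * h0) (by push_cast; ring)
  have e6 : 2 * e ≠ 3 * g := fun h0 => key x (e - g) 0 2 4 3 (sub_ne_zero.2 heg) (by norm_num)
    (by norm_num) (by norm_num) (by norm_num) (by push_cast; ring)
    (by push_cast; linear_combination -h0) (by push_cast; linear_combination -2 * h0)
    (by push_cast; linear_combination -h0)
  have hx : x ∈ A := (hA _).2 (by simp)
  have hx2 : x + 2 * g ∈ A := (hA _).2 (by simp)
  have hz : x + e ∈ A := (hA _).2 (by simp)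
  refine h.false_of_three_differences hbc ih ha.ge hx hx2 hz (by grind) (by grind) (by grind)
    (card_inter_eq_one hx (by simpa using hx2) fun y hy hy' => ?_)
    (card_inter_eq_one hx (by simpa using hz) fun y hy hy' => ?_)
    (card_inter_eq_one hx2 (by simpa using hz) fun y hy hy' => ?_) <;>
  · rw [hA] at hy hy'
    rcases hy with rfl | rfl | rfl | rfl <;> rcases hy' with h0 | h0 | h0 | h0 <;> grind

lemma Critical.false_of_parallelogram (h : Critical A B C) (ha : A.card = 4) {x g k : ZMod p}
    (hg : g ≠ 0) (hk : k ≠ 0) (hgk : g ≠ k) (hgk' : g + k ≠ 0)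
    (hA : ∀ y, y ∈ A ↔ y = x ∨ y = x + g ∨ y = x + k ∨ y = x + g + k) :
    False := by
  obtain ⟨k1, k2, k3, k4, k5, k6, k7, k8⟩ := h.extremal
  have two := two_ne_zero_of_lt (p := p) (by omega)
  have three := three_ne_zero_of_lt (p := p) (by omega)
  have key : ∀ (s d : ZMod p) (i j k' l : ℕ), d ≠ 0 → i ≤ 4 → j ≤ 4 → k' ≤ 4 → l ≤ 4 →
      x = s + i * d → x + g = s + j * d → x + k = s + k' * d → x + g + k = s + l * d → False := by
    intro s d i j k' l hd hi hj hk hl h1 h2 h3 h4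
    refine h.irregular_left.not_quadruple ha hd (s := s) fun y hy => ?_
    rcases (hA y).1 hy with rfl | rfl | rfl | rfl
    exacts [⟨i, hi, h1⟩, ⟨j, hj, h2⟩, ⟨k', hk, h3⟩, ⟨l, hl, h4⟩]
  have e1 : k ≠ 2 * g := fun h0 => key x g 0 1 2 3 hg (by norm_num) (by norm_num) (by norm_num)
    (by norm_num) (by push_cast; ring) (by push_cast; ring) (by push_cast; linear_combination h0)
    (by push_cast; linear_combination h0)
  have e2 : g ≠ 2 * k := fun h0 => key x k 0 2 1 3 hk (by norm_num) (by norm_num) (by norm_num)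
    (by norm_num) (by push_cast; ring) (by push_cast; linear_combination h0) (by push_cast; ring)
    (by push_cast; linear_combination h0)
  have e3 : k ≠ -2 * g := fun h0 => key (x - 2 * g) g 2 3 0 1 hg (by norm_num) (by norm_num)
    (by norm_num) (by norm_num) (by push_cast; ring) (by push_cast; ring)
    (by push_cast; linear_combination h0) (by push_cast; linear_combination h0)
  have e4 : g ≠ -2 * k := fun h0 => key (x - 2 * k) k 2 0 3 1 hk (by norm_num) (by norm_num)
    (by norm_num) (by norm_num) (by push_cast; ring) (by push_cast; linear_combination h0)
    (by push_cast; ring) (by push_cast; linear_combination h0)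
  have m0 : x ∈ A := (hA _).2 (by simp)
  have mg : x + g ∈ A := (hA _).2 (by simp)
  have mk : x + k ∈ A := (hA _).2 (by simp)
  have mgk : x + g + k ∈ A := (hA _).2 (by simp)
  have d1 : (inter A (x + g + k - x)).card = 1 := by
    refine card_inter_eq_one m0 (by simpa using mgk) fun y hy hy' => ?_
    rw [hA] at hy hy'
    rcases hy with rfl | rfl | rfl | rfl <;> rcases hy' with h0 | h0 | h0 | h0 <;> grind
  have d2 : (inter A (x + g - (x + k))).card = 1 := by
    refine card_inter_eq_one mk (by simpa using mg) fun y hy hy' => ?_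
    rw [hA] at hy hy'
    rcases hy with rfl | rfl | rfl | rfl <;> rcases hy' with h0 | h0 | h0 | h0 <;> grind
  obtain ⟨y1, hcase⟩ := h.card_add_residual_cases ha.ge m0 mgk (by grind) d1
  obtain ⟨y2, -⟩ := h.card_add_residual_cases ha.ge mk mg (by grind) d2
  have hcard := k1.card_add_le
  rcases hcase with hcase | ⟨hab, hy⟩
  · have hstep : ∀ s ∈ B.filter (fun s => s - g ∉ B),
        s + -k ∈ B.filter (fun s => s - g ∉ B) := by
      intro s hs
      rw [Finset.mem_filter] at hs ⊢
      have hsk : s - k ∈ B := by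
        rcases sub_mem_or_sub_mem mk mg (by omega) (Finset.add_mem_add m0 hs.1) with hm | hm
        · rwa [show x + s - (x + k) = s - k by ring] at hm
        · rw [show x + s - (x + g) = s - g by ring] at hm
          exact absurd hm hs.2
      rw [← sub_eq_add_neg]
      refine ⟨hsk, fun hm => hs.2 ?_⟩
      have := sub_mem_residual m0 mgk y1.ge hm
        (by rw [show s - k - g + (x + g + k - x) = s by ring]; exact hs.1)
      rw [mem_residual] at this
      have := this _ mk
      rwa [show x + k + (s - k - g - x) = s - g by ring] at this
    have hB : B ≠ Finset.univ := by
      intro h0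
      have := card_univ' (p := p)
      rw [← h0] at this
      omega
    have hne : (B.filter fun s => s - g ∉ B).Nonempty := by
      rw [Finset.filter_nonempty_iff]
      by_contra! hcon
      refine hB (eq_univ_of_forall_add_mem (neg_ne_zero.2 hg) (Finset.card_pos.1 (by omega)) ?_)
      intro s hs
      rw [← sub_eq_add_neg]
      exact hcon s hs
    refine hB (Finset.univ_subset_iff.1 ?_)
    rw [← eq_univ_of_forall_add_mem (neg_ne_zero.2 hk) hne hstep]
    exact Finset.filter_subset _ _
  · obtain ⟨t, ht⟩ := Finset.card_pos.1 (show 0 < (residual A B).card by omega)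
    have hAA := card_add_self_le_of_residual ht
    have hle : (Finset.range 3 ×ˢ Finset.range 3).card ≤ (A + A).card := by
      refine Finset.card_le_card_of_injOn
        (fun q => x + x + ((q.1 : ZMod p) * g + (q.2 : ZMod p) * k)) ?_ ?_
      · rintro ⟨i, j⟩ hq
        simp only [Finset.coe_product, Finset.coe_range, Set.mem_prod, Set.mem_Iio] at hq
        obtain ⟨hi, hj⟩ := hq
        have ms : ∀ i' j' : ℕ, i' ≤ 1 → j' ≤ 1 →
            x + ((i' : ZMod p) * g + (j' : ZMod p) * k) ∈ A := by
          intro i' j' hi' hj'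
          rw [hA]
          interval_cases i' <;> interval_cases j' <;> simp [add_assoc]
        obtain ⟨i1, i2, hi1, hi2, rfl⟩ : ∃ i1 i2, i1 ≤ 1 ∧ i2 ≤ 1 ∧ i = i1 + i2 :=
          ⟨i / 2, i - i / 2, by omega, by omega, by omega⟩
        obtain ⟨j1, j2, hj1, hj2, rfl⟩ : ∃ j1 j2, j1 ≤ 1 ∧ j2 ≤ 1 ∧ j = j1 + j2 :=
          ⟨j / 2, j - j / 2, by omega, by omega, by omega⟩
        refine Finset.mem_coe.2 (Finset.mem_add.2 ⟨_, ms i1 j1 hi1 hj1, _, ms i2 j2 hi2 hj2, ?_⟩)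
        push_cast
        ring
      · rintro ⟨i, j⟩ hq ⟨i', j'⟩ hq' heq
        simp only [Finset.coe_product, Finset.coe_range, Set.mem_prod, Set.mem_Iio] at hq hq'
        obtain ⟨hi, hj⟩ := hq
        obtain ⟨hi', hj'⟩ := hq'
        have heq := add_left_cancel heq
        clear hA hcard hAA key
        simp only at hi hj hi' hj' heq
        interval_cases i <;> interval_cases j <;> interval_cases i' <;> interval_cases j' <;>
          first
          | rfl
          | (exfalso; push_cast at heq; grind)
    rw [Finset.card_product, Finset.card_range] at hle
    omega

lemma Critical.card_ne_four (h : Critical A B C) (hbc : B.card ≤ C.card)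
    (ih : PrecedingHold A B) : A.card ≠ 4 := by
  intro ha
  by_cases hall : ∀ u ∈ A, ∀ v ∈ A, u ≠ v → (inter A (v - u)).card = 1
  · obtain ⟨u, hu, v, hv, w, hw, huv, huw, hvw⟩ :=
      Finset.two_lt_card.1 (show 2 < A.card by omega)
    exact h.false_of_three_differences hbc ih (by omega) hu hv hw huv huw hvw (hall u hu v hv huv)
      (hall u hu w hw huw) (hall v hv w hw hvw)
  push Not at hall
  obtain ⟨k1, k2, k3, k4, k5, k6, k7, k8⟩ := h.extremal
  have two := two_ne_zero_of_lt (p := p) (by omega)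
  obtain ⟨u, hu, v, hv, huv, hne⟩ := hall
  obtain ⟨g, hg⟩ : ∃ g, g = v - u := ⟨_, rfl⟩
  have hg0 : g ≠ 0 := hg ▸ sub_ne_zero.2 huv.symm
  have h1 := h.card_inter_le_two hg0
  have h2 := (inter_nonempty hu hv).card_pos
  rw [← hg] at h2 hne
  obtain ⟨x, x', hxx, hI⟩ := Finset.card_eq_two.1 (show (inter A g).card = 2 by omega)
  obtain ⟨hx, hxg⟩ := mem_inter.1 (show x ∈ inter A g by simp [hI])
  obtain ⟨hx', hxg'⟩ := mem_inter.1 (show x' ∈ inter A g by simp [hI])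
  have chain : ∀ x, x ∈ A → x + g ∈ A → x + 2 * g ∈ A → False := by
    intro x hx hxg hxg'
    have h3 : ({x, x + g, x + 2 * g} : Finset (ZMod p)).card ≤ 3 := Finset.card_le_three
    obtain ⟨z, hz, hz'⟩ := Finset.exists_mem_notMem_of_card_lt_card
      (h3.trans_lt (show 3 < A.card by omega))
    simp only [Finset.mem_insert, Finset.mem_singleton, not_or] at hz'
    obtain ⟨hz1, hz2, hz3⟩ := hz'
    refine h.false_of_chain hbc ih ha (x := x) (g := g) (e := z - x) hg0 (by grind) (by grind)
      (by grind) ?_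
    rw [add_sub_cancel]
    exact mem_iff_of_card_eq_four ha hx hxg hxg' hz (by grind) (by grind) (by grind) (by grind)
      (by grind) (by grind)
  have c1 : x' ≠ x + g := fun h0 => chain x hx hxg (by
    rw [show x + 2 * g = x' + g by rw [h0]; ring]; exact hxg')
  have c2 : x ≠ x' + g := fun h0 => chain x' hx' hxg' (by
    rw [show x' + 2 * g = x + g by rw [h0]; ring]; exact hxg)
  refine h.false_of_parallelogram ha (x := x) (g := g) (k := x' - x) hg0 (by grind) (by grind)
    (by grind) ?_
  rw [add_sub_cancel, show x + g + (x' - x) = x' + g by ring]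
  exact mem_iff_of_card_eq_four ha hx hxg hx' hxg' (by grind) (by grind) (by grind) (by grind)
    (by grind) (by grind)

end Critical

/-- The theorem for triples of sets. -/
theorem Extremal.allAlmostAP {A B C : Finset (ZMod p)} (h : Extremal A B C) :
    AllAlmostAP A B C := by
  refine trio_induction (R := fun A B C => Extremal A B C → AllAlmostAP A B C)
    (fun A B C ih h => (ih h.swap).swap) (fun A B C ih h => (ih h.rotate.rotate).rotate) ?_ A B C h
  intro A B C hab hbc ih h
  by_contra hno
  have hc : Critical A B C :=
    { extremal := h
      irregular_left := h.rotate.irregular fun h' => hno h'.rotate.rotate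
      irregular_mid := h.rotate.rotate.irregular fun h' => hno h'.rotate
      irregular_right := h.irregular hno
      left_le_mid := hab
      left_le_right := hab.trans hbc
      minimal := fun A' B' C' hlt => ih A' B' C' (Or.inl hlt) }
  have h3 := hc.card_lt_five hbc ih
  have h4 := hc.card_ne_three hbc ih
  have h5 := hc.card_ne_four hbc ih
  have h6 := h.three_le_left
  omega

end HamidouneRodseth

/-- (Hamidoune–Rødseth) Let `p` be a prime and let `A` and `B` be subsets of `ℤ/pℤ`
with `|A| ≥ 3` and `|B| ≥ 4` such that `|A + B| = |A| + |B| ≤ p − 4`.  Then `A` and `B`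
are contained in arithmetic progressions with the same common difference, of respective
lengths `|A| + 1` and `|B| + 1`. -/
theorem hamidoune_rodseth (p : ℕ) (hp : p.Prime) (A B : Finset (ZMod p))
    (hA : 3 ≤ A.card) (hB : 4 ≤ B.card)
    (hsum : (A + B).card = A.card + B.card) (hle : A.card + B.card ≤ p - 4) :
    ∃ d x y : ZMod p,
      A ⊆ (Finset.range (A.card + 1)).image (fun j : ℕ => x + (j : ZMod p) * d) ∧
      B ⊆ (Finset.range (B.card + 1)).image (fun j : ℕ => y + (j : ZMod p) * d) := by
  have : Fact p.Prime := ⟨hp⟩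
  have h1 := HamidouneRodseth.card_image_neg_compl (A + B)
  have htrio : HamidouneRodseth.Trio A B ((A + B)ᶜ.image (-·)) := HamidouneRodseth.trio_neg_compl A B
  obtain ⟨d, -, ⟨x, hx⟩, ⟨y, hy⟩, -⟩ := HamidouneRodseth.Extremal.allAlmostAP
    ⟨htrio, hA, by omega, by omega, by omega, by omega, by omega, by omega⟩
  exact ⟨d, x, y, hx, hy⟩
end

section
/- (Erdős–Heilbronn, proved by Alon–Nathanson–Ruzsa) Let p be a prime and let A and B be nonempty subsets of F = ℤ/pℤ with |A| = k and |B| = ℓ. If p ≥ k + ℓ − 3, then the restricted sumset satisfies |A ∔ B| ≥ k + ℓ − 3. -/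
open MvPolynomial in
theorem coeff_X_add_X_pow {R : Type*} [CommSemiring R] (n : ℕ) (d : Fin 2 →₀ ℕ) :
    coeff d ((X 0 + X 1 : MvPolynomial (Fin 2) R) ^ n) =
      if d 0 + d 1 = n then (n.choose (d 0) : R) else 0 := by
  have hmon (i j : ℕ) : coeff d ((X 0 : MvPolynomial (Fin 2) R) ^ i * X 1 ^ j *
        (n.choose i : MvPolynomial (Fin 2) R)) =
      if i = d 0 ∧ j = d 1 then (n.choose i : R) else 0 := by
    rw [← map_natCast (C : R →+* MvPolynomial (Fin 2) R), mul_comm _ (C _), coeff_C_mul,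
      X_pow_eq_monomial, X_pow_eq_monomial, monomial_mul, coeff_monomial]
    have : Finsupp.single 0 i + Finsupp.single 1 j = d ↔ i = d 0 ∧ j = d 1 := by
      simp [Finsupp.ext_iff, Fin.forall_fin_two]
    simp [this]
  rw [add_pow, coeff_sum]
  simp_rw [hmon]
  split_ifs with h
  · rw [Finset.sum_eq_single (d 0)]
    · rw [if_pos ⟨rfl, by omega⟩]
    · intro i _ hi
      exact if_neg fun h ↦ hi h.1
    · intro hi
      simp at hi
      omega
  · refine Finset.sum_eq_zero fun i hi ↦ if_neg ?_
    simp at hi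
    omega

open MvPolynomial in
/-- If `P` is monic of degree `a + b` and the coefficient of `x ^ (a + 1) * y ^ b` in
`(x - y) * (x + y) ^ (a + b)` is nonzero, then `(x - y) * P(x + y)` does not vanish identically on
a grid `A × B` with `a + 1 < |A|` and `b < |B|`. -/
theorem exists_ne_and_eval_add_ne_zero {R : Type*} [CommRing R] [IsDomain R] (P : Polynomial R)
    (hP : P.Monic) {a b : ℕ} (hdeg : P.natDegree = a + b)
    (hab : ((a + b).choose a : R) ≠ (a + b).choose (a + 1))
    {A B : Finset R} (hA : a + 1 < A.card) (hB : b < B.card) :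
    ∃ x ∈ A, ∃ y ∈ B, x ≠ y ∧ P.eval (x + y) ≠ 0 := by
  set u : MvPolynomial (Fin 2) R := X 0 + X 1 with hu
  set f : MvPolynomial (Fin 2) R := (X 0 - X 1) * Polynomial.aeval u P with hf
  set t : Fin 2 →₀ ℕ := Finsupp.single 0 (a + 1) + Finsupp.single 1 b with ht
  have ht0 : t 0 = a + 1 := by simp [ht]
  have ht1 : t 1 = b := by simp [ht]
  have htdeg : t.degree = a + b + 1 := by
    simp [ht]; omega
  have hhom : (X 0 - X 1 : MvPolynomial (Fin 2) R).IsHomogeneous 1 :=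
    (isHomogeneous_X R 0).sub (isHomogeneous_X R 1)
  have huhom (i : ℕ) : (u ^ i).IsHomogeneous i := by
    simpa using ((isHomogeneous_X R (0 : Fin 2)).add (isHomogeneous_X R 1)).pow i
  have hsum : f = ∑ i ∈ Finset.range (a + b + 1), C (P.coeff i) * ((X 0 - X 1) * u ^ i) := by
    rw [hf, Polynomial.aeval_eq_sum_range, hdeg, Finset.mul_sum]
    refine Finset.sum_congr rfl fun i _ ↦ ?_
    rw [smul_eq_C_mul]
    ring
  have htop : coeff t ((X 0 - X 1) * u ^ (a + b)) =
      ((a + b).choose a : R) - (a + b).choose (a + 1) := by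
    rw [sub_mul, coeff_sub, coeff_X_mul', coeff_X_mul', hu, coeff_X_add_X_pow, coeff_X_add_X_pow]
    rcases b with _ | b
    · simp [ht]
    · have h1 : a + 1 + b = a + (b + 1) := by omega
      simp [ht, h1]
  have hcoeff : coeff t f = ((a + b).choose a : R) - (a + b).choose (a + 1) := by
    rw [hsum, coeff_sum, Finset.sum_eq_single (a + b)]
    · rw [coeff_C_mul, htop, ← hdeg, hP.coeff_natDegree, one_mul]
    · intro i _ hi
      rw [coeff_C_mul, (hhom.mul (huhom i)).coeff_eq_zero (by rw [htdeg]; omega), mul_zero]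
    · simp
  have hne : coeff t f ≠ 0 := by rwa [hcoeff, sub_ne_zero]
  have hle : f.totalDegree ≤ t.degree := by
    rw [hsum, htdeg]
    refine totalDegree_finsetSum_le fun i hi ↦ ?_
    refine (totalDegree_mul _ _).trans ?_
    rw [totalDegree_C, zero_add]
    refine (hhom.mul (huhom i)).totalDegree_le.trans ?_
    simp at hi
    omega
  have hge : t.degree ≤ f.totalDegree := by
    simpa [Finsupp.degree_apply, Finsupp.sum] using le_totalDegree (mem_support_iff.mpr hne)
  obtain ⟨s, hs, hev⟩ := combinatorial_nullstellensatz_exists_eval_nonzero f t hne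
    (le_antisymm hle hge) ![A, B] (by simp [Fin.forall_fin_two, ht0, ht1, hA, hB])
  have heval : eval s f = (s 0 - s 1) * P.eval (s 0 + s 1) := by
    rw [hf, map_mul, ← MvPolynomial.coe_aeval_eq_eval, RingHom.coe_coe,
      ← Polynomial.aeval_algHom_apply]
    simp [hu]
  rw [heval] at hev
  exact ⟨s 0, hs 0, s 1, hs 1, sub_ne_zero.mp (left_ne_zero_of_mul hev),
    right_ne_zero_of_mul hev⟩

theorem ZMod.choose_ne_choose_succ {p a b : ℕ} (hp : p.Prime) (hba : b ≤ a) (ha : a + 1 < p)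
    (hab : a + b < p) :
    ((a + b).choose a : ZMod p) ≠ (a + b).choose (a + 1) := by
  have : Fact p.Prime := ⟨hp⟩
  intro h
  have hchoose : ((a + b).choose a : ZMod p) ≠ 0 := by
    rw [Ne, ZMod.natCast_eq_zero_iff]
    intro hdvd
    have := (hp.dvd_factorial (n := a + b)).mp
      (Nat.choose_mul_factorial_mul_factorial (Nat.le_add_right a b) ▸
        (hdvd.mul_right _).mul_right _)
    omega
  have hrec := congrArg (Nat.cast (R := ZMod p)) (Nat.choose_succ_right_eq (a + b) a)
  rw [Nat.add_sub_cancel_left, Nat.cast_mul, Nat.cast_mul, ← h] at hrec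
  have hmod := (ZMod.natCast_eq_natCast_iff _ _ _).mp (mul_left_cancel₀ hchoose hrec)
  have hdvd := (Nat.modEq_iff_dvd' (by omega)).mp hmod.symm
  have := Nat.le_of_dvd (by omega) hdvd
  omega

/-- Lower bound on the restricted sumset of two sets of different cardinalities. -/
theorem ZMod.card_add_card_sub_two_le_card_restricted_sumset {p : ℕ} (hp : p.Prime)
    {A B : Finset (ZMod p)} (hB : B.Nonempty) (hBA : B.card < A.card)
    (hpAB : A.card + B.card - 2 ≤ p) :
    A.card + B.card - 2 ≤
      (((A ×ˢ B).filter fun q => q.1 ≠ q.2).image fun q => q.1 + q.2).card := by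
  have : Fact p.Prime := ⟨hp⟩
  have hBpos := hB.card_pos
  have hAp : A.card ≤ p := by simpa [ZMod.card] using Finset.card_le_univ A
  obtain ⟨a, ha⟩ : ∃ a, A.card = a + 2 := ⟨A.card - 2, by omega⟩
  obtain ⟨b, hb⟩ : ∃ b, B.card = b + 1 := ⟨B.card - 1, by omega⟩
  set S := ((A ×ˢ B).filter fun q => q.1 ≠ q.2).image fun q => q.1 + q.2 with hS
  by_contra! hcard
  have hQ : (∏ c ∈ S, (Polynomial.X - Polynomial.C c)).Monic :=
    Polynomial.monic_prod_X_sub_C _ _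
  obtain ⟨x, hx, y, hy, hxy, hne⟩ := exists_ne_and_eval_add_ne_zero
    (Polynomial.X ^ (a + b - S.card) * ∏ c ∈ S, (Polynomial.X - Polynomial.C c))
    ((Polynomial.monic_X_pow _).mul hQ) (a := a) (b := b)
    (by
      rw [(Polynomial.monic_X_pow _).natDegree_mul hQ, Polynomial.natDegree_X_pow,
        Polynomial.natDegree_finsetProd_X_sub_C_eq_card]
      omega)
    (ZMod.choose_ne_choose_succ hp (by omega) (by omega) (by omega)) (A := A) (B := B)
    (by omega) (by omega)
  refine hne ?_
  rw [Polynomial.eval_mul, Polynomial.eval_prod, Finset.prod_eq_zero (i := x + y), mul_zero]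
  · simp only [hS, Finset.mem_image, Finset.mem_filter, Finset.mem_product]
    exact ⟨(x, y), ⟨⟨hx, hy⟩, hxy⟩, rfl⟩
  · simp

theorem ZMod.card_add_card_sub_three_le_card_restricted_sumset {p : ℕ} (hp : p.Prime)
    {A B : Finset (ZMod p)} (hB : B.Nonempty) (hBA : B.card ≤ A.card)
    (hpAB : A.card + B.card - 3 ≤ p) :
    A.card + B.card - 3 ≤
      (((A ×ˢ B).filter fun q => q.1 ≠ q.2).image fun q => q.1 + q.2).card := by
  obtain ⟨b, hb⟩ := hB
  obtain hB1 | hB1 := Nat.lt_or_ge 1 B.card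
  · have hcard := Finset.card_erase_of_mem hb
    have hle := card_add_card_sub_two_le_card_restricted_sumset hp (A := A) (B := B.erase b)
      (Finset.card_pos.mp (by omega)) (by omega) (by omega)
    have hmono : (((A ×ˢ B.erase b).filter fun q => q.1 ≠ q.2).image fun q => q.1 + q.2).card ≤
        (((A ×ˢ B).filter fun q => q.1 ≠ q.2).image fun q => q.1 + q.2).card := by
      gcongr
      exact Finset.erase_subset _ _
    omega
  · have hsub : (A.erase b).image (· + b) ⊆
        ((A ×ˢ B).filter fun q => q.1 ≠ q.2).image fun q => q.1 + q.2 := by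
      intro x
      simp only [Finset.mem_image, Finset.mem_erase, Finset.mem_filter, Finset.mem_product]
      rintro ⟨a, ⟨hab, ha⟩, rfl⟩
      exact ⟨(a, b), ⟨⟨ha, hb⟩, hab⟩, rfl⟩
    have hle := Finset.card_le_card hsub
    rw [Finset.card_image_of_injective _ (add_left_injective b)] at hle
    have := Finset.pred_card_le_card_erase (s := A) (a := b)
    omega

/-- (Erdős–Heilbronn, proved by Alon–Nathanson–Ruzsa) Let `p` be a prime and let `A` and
`B` be nonempty subsets of `F = ℤ/pℤ` with `|A| = k` and `|B| = ℓ`.  If `p ≥ k + ℓ − 3`,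
then the restricted sumset `A ∔ B = {a + b : a ∈ A, b ∈ B, a ≠ b}` satisfies
`|A ∔ B| ≥ k + ℓ − 3`. -/
theorem erdos_heilbronn (p k ℓ : ℕ) (hp : p.Prime) (A B : Finset (ZMod p))
    (hA : A.Nonempty) (hB : B.Nonempty) (hAk : A.card = k) (hBl : B.card = ℓ)
    (hpk : k + ℓ - 3 ≤ p) :
    k + ℓ - 3 ≤ ((((A ×ˢ B).filter fun q => q.1 ≠ q.2).image fun q => q.1 + q.2)).card := by
  subst hAk hBl
  obtain h | h := le_total B.card A.card
  · exact ZMod.card_add_card_sub_three_le_card_restricted_sumset hp hB h hpk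
  · have hswap : (((A ×ˢ B).filter fun q => q.1 ≠ q.2).image fun q => q.1 + q.2) =
        (((B ×ˢ A).filter fun q => q.1 ≠ q.2).image fun q => q.1 + q.2) := by
      ext x
      simp only [Finset.mem_image, Finset.mem_filter, Finset.mem_product, Prod.exists]
      constructor <;> rintro ⟨a, b, ⟨⟨ha, hb⟩, hab⟩, rfl⟩ <;>
        exact ⟨b, a, ⟨⟨hb, ha⟩, hab.symm⟩, add_comm b a⟩
    rw [hswap, add_comm A.card]
    exact ZMod.card_add_card_sub_three_le_card_restricted_sumset hp hA h (by omega)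
end

section
/- (Dias da Silva–Hamidoune) Let p be a prime and let A be a nonempty subset of F = ℤ/pℤ with |A| = k. If p ≥ 2k − 3, then the restricted sumset of A with itself satisfies |A ∔ A| ≥ 2k − 3. -/
open MvPolynomial in
/-- The product of the linear forms `X₀ + X₁ - c` has total degree at most the number of factors. -/
theorem totalDegree_prod_X_add_X_sub_C_le {R : Type*} [CommRing R] (s : Multiset R) :
    ((s.map fun c => (X 0 + X 1 - C c : MvPolynomial (Fin 2) R)).prod).totalDegree ≤ s.card := by
  refine (totalDegree_multiset_prod _).trans ?_
  rw [Multiset.map_map]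
  refine (Multiset.sum_le_card_nsmul _ 1 ?_).trans (by simp)
  intro d hd
  obtain ⟨c, -, rfl⟩ := Multiset.mem_map.1 hd
  have hX (i : Fin 2) : (X i : MvPolynomial (Fin 2) R).totalDegree ≤ 1 :=
    (totalDegree_monomial_le _ _).trans (by simp)
  refine (totalDegree_sub _ _).trans (max_le ((totalDegree_add _ _).trans ?_) (by simp))
  exact max_le (hX 0) (hX 1)

open MvPolynomial in
/-- The top-degree coefficients of a product of linear forms `X₀ + X₁ - c` are binomial. -/
theorem coeff_prod_X_add_X_sub_C {R : Type*} [CommRing R] (s : Multiset R) :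
    ∀ a b : ℕ, a + b = s.card →
      coeff (Finsupp.single 0 a + Finsupp.single 1 b)
        ((s.map fun c => (X 0 + X 1 - C c : MvPolynomial (Fin 2) R)).prod) =
          (s.card.choose a : R) := by
  induction s using Multiset.induction_on with
  | empty =>
    intro a b hab
    obtain ⟨rfl, rfl⟩ : a = 0 ∧ b = 0 := by simpa using hab
    simp
  | cons c s ih =>
    intro a b hab
    rw [Multiset.card_cons] at hab ⊢
    have hlow : coeff (Finsupp.single 0 a + Finsupp.single 1 b)
        ((s.map fun c => (X 0 + X 1 - C c : MvPolynomial (Fin 2) R)).prod) = 0 := by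
      apply coeff_eq_zero_of_totalDegree_lt
      change _ < (Finsupp.single 0 a + Finsupp.single 1 b : Fin 2 →₀ ℕ).degree
      have := totalDegree_prod_X_add_X_sub_C_le s
      simp only [map_add, Finsupp.degree_single]
      omega
    rw [Multiset.map_cons, Multiset.prod_cons, sub_mul, add_mul, coeff_sub, coeff_add,
      coeff_C_mul, hlow, mul_zero, sub_zero]
    rcases a with _ | a
    · obtain rfl : b = s.card + 1 := by omega
      have h := ih 0 s.card (by omega)
      simp only [Finsupp.single_zero, zero_add] at h ⊢
      rw [Finsupp.single_add, add_comm (Finsupp.single _ _), coeff_X_mul, add_comm, h]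
      simp [coeff_X_mul']
    · rw [Finsupp.single_add, add_comm (Finsupp.single 0 a), add_assoc, coeff_X_mul,
        ih a b (by omega), Nat.choose_succ_succ, Nat.cast_add]
      congr 1
      rcases b with _ | b
      · rw [Nat.choose_eq_zero_of_lt (by omega)]
        simp [coeff_X_mul']
      · have hsplit : Finsupp.single 0 1 + (Finsupp.single 0 a + Finsupp.single 1 (b + 1)) =
            Finsupp.single 1 1 +
              (Finsupp.single 0 (a + 1) + Finsupp.single 1 b : Fin 2 →₀ ℕ) := by
          simp only [Finsupp.single_add]
          abel
        rw [hsplit, coeff_X_mul, ih (a + 1) b (by omega)]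

/-- A ballot number `choose (2n) n - choose (2n) (n + 1)` is nonzero modulo a prime above `2n`. -/
theorem choose_sub_choose_succ_ne_zero {p n : ℕ} (hp : p.Prime) (hn : 2 * n < p) :
    ((2 * n).choose n : ZMod p) - ((2 * n).choose (n + 1) : ZMod p) ≠ 0 := by
  have hrec : (((2 * n).choose (n + 1) * (n + 1) : ℕ) : ZMod p) = ((2 * n).choose n * n : ℕ) := by
    rw [Nat.choose_succ_right_eq, two_mul, Nat.add_sub_cancel]
  have hchoose : ((2 * n).choose n : ZMod p) ≠ 0 := by
    rw [Ne, ZMod.natCast_eq_zero_iff]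
    intro h
    have hfac : p ∣ (2 * n).factorial := by
      rw [← Nat.choose_mul_factorial_mul_factorial (show n ≤ 2 * n by omega), mul_assoc]
      exact h.mul_right _
    exact absurd ((hp.dvd_factorial).1 hfac) (by omega)
  intro h
  apply hchoose
  push_cast at hrec
  linear_combination (n + 1 : ZMod p) * h + hrec

open MvPolynomial in
/-- (Dias da Silva–Hamidoune) Let `p` be a prime and let `A` be a nonempty subset of
`F = ℤ/pℤ` with `|A| = k`.  If `p ≥ 2k − 3`, then the restricted sumset
`A ∔ A = {a + a' : a ∈ A, a' ∈ A, a ≠ a'}` satisfies `|A ∔ A| ≥ 2k − 3`. -/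
theorem dias_da_silva_hamidoune (p k : ℕ) (hp : p.Prime) (A : Finset (ZMod p))
    (hA : A.Nonempty) (hAk : A.card = k) (hpk : 2 * k - 3 ≤ p) :
    2 * k - 3 ≤ ((((A ×ˢ A).filter fun q => q.1 ≠ q.2).image fun q => q.1 + q.2)).card := by
  classical
  have : Fact p.Prime := ⟨hp⟩
  by_contra! hlt
  obtain ⟨n, rfl⟩ : ∃ n, k = n + 2 := ⟨k - 2, by omega⟩
  set S := ((A ×ˢ A).filter fun q => q.1 ≠ q.2).image fun q => q.1 + q.2
  set s : Multiset (ZMod p) := S.val + Multiset.replicate (2 * n - S.card) 0 with hs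
  have hcard : s.card = 2 * n := by
    rw [hs, Multiset.card_add, Multiset.card_replicate, Finset.card_val]
    omega
  set P : MvPolynomial (Fin 2) (ZMod p) := (s.map fun c => X 0 + X 1 - C c).prod with hP
  set t : Fin 2 →₀ ℕ := Finsupp.single 0 (n + 1) + Finsupp.single 1 n with ht
  have hcoeff : coeff t ((X 0 - X 1) * P) ≠ 0 := by
    have h0 : coeff t (X 0 * P) = ((2 * n).choose n : ZMod p) := by
      rw [ht, Finsupp.single_add, add_comm (Finsupp.single 0 n), add_assoc, coeff_X_mul, hP,
        coeff_prod_X_add_X_sub_C s n n (by omega), hcard]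
    have h1 : coeff t (X 1 * P) = ((2 * n).choose (n + 1) : ZMod p) := by
      rcases n with _ | n
      · simp [ht, coeff_X_mul']
      · rw [ht, Finsupp.single_add 1, add_comm (Finsupp.single 1 n), add_left_comm, coeff_X_mul,
          hP, coeff_prod_X_add_X_sub_C s _ _ (by omega), hcard]
    rw [sub_mul, coeff_sub, h0, h1]
    exact choose_sub_choose_succ_ne_zero hp (by omega)
  have htdeg : t.degree = 2 * n + 1 := by
    simp only [ht, map_add, Finsupp.degree_single]
    omega
  have hdeg : ((X 0 - X 1) * P).totalDegree = t.degree := by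
    apply le_antisymm
    · have hlin : (X 0 - X 1 : MvPolynomial (Fin 2) (ZMod p)).totalDegree ≤ 1 :=
        (totalDegree_sub _ _).trans (by simp)
      have hprod : P.totalDegree ≤ s.card := totalDegree_prod_X_add_X_sub_C_le s
      have := totalDegree_mul (X 0 - X 1) P
      omega
    · exact le_totalDegree (mem_support_iff.2 hcoeff)
  obtain ⟨a, ha⟩ := hA
  obtain ⟨x, hx, hne⟩ := combinatorial_nullstellensatz_exists_eval_nonzero _ t hcoeff hdeg
    ![A, A.erase a] (by
      intro i
      fin_cases i
      · simp [ht, hAk]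
      · simp [ht, hAk, Finset.card_erase_of_mem ha])
  have hx0 : x 0 ∈ A := hx 0
  have hx1 : x 1 ∈ A := Finset.mem_of_mem_erase (hx 1)
  apply hne
  rw [map_mul]
  by_cases hxx : x 0 = x 1
  · simp [hxx]
  · have hmem : x 0 + x 1 ∈ s :=
      Multiset.mem_add.2 <| Or.inl <| Finset.mem_image.2
        ⟨(x 0, x 1), by simp [hx0, hx1, hxx], rfl⟩
    rw [hP, map_multiset_prod, Multiset.map_map]
    refine mul_eq_zero_of_right _ (Multiset.prod_eq_zero (Multiset.mem_map.2 ⟨_, hmem, ?_⟩))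
    simp
end
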